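/- arXiv:math/0212280 — 4 statements merged into one kernel-verified Lean document; each statement's English description precedes it below -/
import Mathlib

section
/- If a finite group G acts freely and continuously on a finite CW complex X homotopy equivalent to the k-torus (S^1)^k (a product of k circles), then r_2(G) ≤ k; that is, G contains no subgroup isomorphic to (ℤ/2)^{k+1}. -/
open Metric

/-- `Sph n` is the unit sphere `S^n`, i.e. the set of unit vectors in `ℝ^{n+1}`. -/
abbrev Sph (n : ℕ) : Type := Metric.sphere (0 : EuclideanSpace ℝ (Fin (n + 1))) 1

/-- The self-homeomorphisms of a topological space form a group under composition.
A continuous action of a group `G` on `X` (every element acting by a homeomorphism)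
is then precisely a group homomorphism `G →* (X ≃ₜ X)`. -/
instance homeoGroup (X : Type*) [TopologicalSpace X] : Group (X ≃ₜ X) where
  mul e f := f.trans e
  one := Homeomorph.refl X
  inv := Homeomorph.symm
  mul_assoc _ _ _ := Homeomorph.ext fun _ => rfl
  one_mul _ := Homeomorph.ext fun _ => rfl
  mul_one _ := Homeomorph.ext fun _ => rfl
  inv_mul_cancel e := Homeomorph.ext fun x => e.symm_apply_apply x

/-- The boundary sphere `S^{n-1}` of an `n`-cell: the unit sphere in `ℝ^n`. -/
abbrev CellBoundary (n : ℕ) : Type := Metric.sphere (0 : EuclideanSpace ℝ (Fin n)) 1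

/-- A closed `n`-cell: the closed unit ball `D^n` in `ℝ^n`. -/
abbrev Cell (n : ℕ) : Type := Metric.closedBall (0 : EuclideanSpace ℝ (Fin n)) 1

/-- The space obtained from `X` by attaching `k` cells of dimension `n` along the attaching
maps `f i : S^{n-1} → X`: the quotient of the disjoint union `X ⊔ (Fin k × D^n)` obtained by
identifying each boundary point of each disk with its image under the corresponding
attaching map, endowed with the quotient topology. -/
abbrev AttachCells (n k : ℕ) (X : Type) [TopologicalSpace X]
    (f : Fin k → C(CellBoundary n, X)) : Type :=
  Quot (fun a b : X ⊕ (Σ _ : Fin k, Cell n) =>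
    ∃ (i : Fin k) (s : CellBoundary n),
      a = Sum.inl (f i s) ∧ b = Sum.inr ⟨i, ⟨s.1, Metric.sphere_subset_closedBall s.2⟩⟩)

/-- `IsFiniteCWAtMost n X` : the space `X` is a finite CW complex of dimension at most `n`,
i.e. it is built from the empty space by attaching, for each dimension `0, 1, …, n` in
increasing order, finitely many cells of that dimension (and it is allowed to skip
dimensions, and to replace the space by a homeomorphic copy). -/
inductive IsFiniteCWAtMost : (n : ℕ) → (X : Type) → [TopologicalSpace X] → Prop
  | base (k : ℕ) (f : Fin k → C(CellBoundary 0, Empty)) :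
      IsFiniteCWAtMost 0 (AttachCells 0 k Empty f)
  | up {n : ℕ} {X : Type} [TopologicalSpace X] :
      IsFiniteCWAtMost n X → IsFiniteCWAtMost (n + 1) X
  | attach {n : ℕ} {X : Type} [TopologicalSpace X] (hX : IsFiniteCWAtMost n X)
      (k : ℕ) (f : Fin k → C(CellBoundary (n + 1), X)) :
      IsFiniteCWAtMost (n + 1) (AttachCells (n + 1) k X f)
  | homeo {n : ℕ} {X Y : Type} [TopologicalSpace X] [TopologicalSpace Y]
      (hX : IsFiniteCWAtMost n X) (e : X ≃ₜ Y) : IsFiniteCWAtMost n Y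

/-- `X` is a finite CW complex: it can be built from finitely many cells, attached in
order of increasing dimension. -/
def IsFiniteCW (X : Type) [TopologicalSpace X] : Prop :=
  ∃ n, IsFiniteCWAtMost n X

/-- The space `X` is compact and its points are separated by continuous real functions. -/
def IsCompactSeparated (X : Type*) [TopologicalSpace X] : Prop :=
  CompactSpace X ∧ ∀ x y : X, x ≠ y → ∃ u : C(X, ℝ), u x ≠ u y

/-- Continuous functions on `X` and on the cells that agree along the attaching maps glue. -/
noncomputable def AttachCells.glue {n k : ℕ} {X : Type} [TopologicalSpace X]
    (f : Fin k → C(CellBoundary n, X)) (u : C(X, ℝ)) (v : Fin k → C(Cell n, ℝ))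
    (h : ∀ i (s : CellBoundary n), u (f i s) = v i ⟨s.1, Metric.sphere_subset_closedBall s.2⟩) :
    C(AttachCells n k X f, ℝ) where
  toFun := Quot.lift (Sum.elim u fun c => v c.1 c.2) <| by
    rintro _ _ ⟨i, s, rfl, rfl⟩
    exact h i s
  continuous_toFun := continuous_quot_lift _ <|
    u.continuous.sumElim (continuous_sigma fun i => (v i).continuous)

lemma AttachCells.glue_inl {n k : ℕ} {X : Type} [TopologicalSpace X]
    (f : Fin k → C(CellBoundary n, X)) (u : C(X, ℝ)) (v : Fin k → C(Cell n, ℝ))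
    (h : ∀ i (s : CellBoundary n), u (f i s) = v i ⟨s.1, Metric.sphere_subset_closedBall s.2⟩)
    (x : X) : AttachCells.glue f u v h (Quot.mk _ (Sum.inl x)) = u x := rfl

lemma AttachCells.glue_inr {n k : ℕ} {X : Type} [TopologicalSpace X]
    (f : Fin k → C(CellBoundary n, X)) (u : C(X, ℝ)) (v : Fin k → C(Cell n, ℝ))
    (h : ∀ i (s : CellBoundary n), u (f i s) = v i ⟨s.1, Metric.sphere_subset_closedBall s.2⟩)
    (i : Fin k) (c : Cell n) : AttachCells.glue f u v h (Quot.mk _ (Sum.inr ⟨i, c⟩)) = v i c := rfl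

/-- A continuous function on `X` extends over the attached cells. -/
lemma AttachCells.exists_extension {n k : ℕ} {X : Type} [TopologicalSpace X]
    (f : Fin k → C(CellBoundary n, X)) (u : C(X, ℝ)) :
    ∃ w : C(AttachCells n k X f, ℝ), ∀ x, w (Quot.mk _ (Sum.inl x)) = u x := by
  have hcpt : CompactSpace (CellBoundary n) := isCompact_iff_compactSpace.mp (isCompact_sphere _ _)
  let j : CellBoundary n → Cell n := fun s => ⟨s.1, Metric.sphere_subset_closedBall s.2⟩
  have hj : Topology.IsClosedEmbedding j :=
    Continuous.isClosedEmbedding (by fun_prop) fun a b hab => Subtype.ext (congrArg (·.1) hab)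
  choose v hv using fun i => (u.comp (f i)).exists_extension hj
  exact ⟨AttachCells.glue f u v fun i s => (DFunLike.congr_fun (hv i) s).symm, fun x => rfl⟩

/-- A continuous function on one cell that vanishes on its boundary extends by zero. -/
lemma AttachCells.exists_extension_zero {n k : ℕ} {X : Type} [TopologicalSpace X]
    (f : Fin k → C(CellBoundary n, X)) (i : Fin k) (v : C(Cell n, ℝ))
    (hv : ∀ c : Cell n, ‖c.1‖ = 1 → v c = 0) :
    ∃ w : C(AttachCells n k X f, ℝ), (∀ x, w (Quot.mk _ (Sum.inl x)) = 0) ∧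
      (∀ c, w (Quot.mk _ (Sum.inr ⟨i, c⟩)) = v c) ∧
      ∀ j c, j ≠ i → w (Quot.mk _ (Sum.inr ⟨j, c⟩)) = 0 := by
  obtain ⟨V, hVi, hVj⟩ : ∃ V : Fin k → C(Cell n, ℝ),
      V i = v ∧ ∀ j, j ≠ i → V j = ContinuousMap.const _ 0 := by
    classical
    exact ⟨Function.update (fun _ => ContinuousMap.const _ 0) i v, Function.update_self .., fun j h =>
      Function.update_of_ne h ..⟩
  have hglue : ∀ j (s : CellBoundary n),
      ContinuousMap.const X (0 : ℝ) (f j s) = V j ⟨s.1, Metric.sphere_subset_closedBall s.2⟩ := by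
    intro j s
    rw [ContinuousMap.const_apply]
    by_cases h : j = i
    · rw [h, hVi]
      have hs : ‖s.1‖ = 1 := mem_sphere_zero_iff_norm.mp s.2
      exact (hv ⟨s.1, Metric.sphere_subset_closedBall s.2⟩ hs).symm
    · rw [hVj j h, ContinuousMap.const_apply]
  refine ⟨AttachCells.glue f (ContinuousMap.const X 0) V hglue, fun x => ?_, fun c => ?_, fun j c h => ?_⟩
  · rw [AttachCells.glue_inl, ContinuousMap.const_apply]
  · rw [AttachCells.glue_inr, hVi]
  · rw [AttachCells.glue_inr, hVj j h, ContinuousMap.const_apply]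

lemma IsCompactSeparated.attachCells {n k : ℕ} {X : Type} [TopologicalSpace X]
    (hX : IsCompactSeparated X) (f : Fin k → C(CellBoundary n, X)) :
    IsCompactSeparated (AttachCells n k X f) := by
  have := hX.1
  have hcpt : CompactSpace (Cell n) := isCompact_iff_compactSpace.mp (isCompact_closedBall _ _)
  refine ⟨inferInstance, ?_⟩
  /- Every point is in `X` or in the interior of a cell. -/
  have hrep : ∀ x : AttachCells n k X f, (∃ a, x = Quot.mk _ (Sum.inl a)) ∨
      ∃ i, ∃ c : Cell n, ‖c.1‖ < 1 ∧ x = Quot.mk _ (Sum.inr ⟨i, c⟩) := by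
    rintro ⟨a | ⟨i, c⟩⟩
    · exact .inl ⟨a, rfl⟩
    · rcases (mem_closedBall_zero_iff.mp c.2).lt_or_eq with h | h
      · exact .inr ⟨i, c, h, rfl⟩
      · let s : CellBoundary n := ⟨c.1, mem_sphere_zero_iff_norm.mpr h⟩
        exact .inl ⟨f i s, (Quot.sound ⟨i, s, rfl, rfl⟩).symm⟩
  /- An interior point of a cell is separated from every other point. -/
  have hsep : ∀ (i : Fin k) (c : Cell n), ‖c.1‖ < 1 → ∀ y : AttachCells n k X f,
      (Quot.mk _ (Sum.inr ⟨i, c⟩)) ≠ y →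
      ∃ u : C(AttachCells n k X f, ℝ), u (Quot.mk _ (Sum.inr ⟨i, c⟩)) ≠ u y := by
    intro i c hc y hne
    obtain ⟨w, hw0, hwi, hwj⟩ := AttachCells.exists_extension_zero f i
      ⟨fun d : Cell n => 1 - ‖d.1‖, by fun_prop⟩ (fun d hd => by simp [hd])
    have hwc : w (Quot.mk _ (Sum.inr ⟨i, c⟩)) ≠ 0 := by
      rw [hwi]
      exact (sub_pos.mpr hc).ne'
    rcases hrep y with ⟨a, rfl⟩ | ⟨j, d, hd, rfl⟩
    · exact ⟨w, by rwa [hw0]⟩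
    · by_cases hji : j = i
      · subst hji
        by_cases hwd : w (Quot.mk _ (Sum.inr ⟨j, c⟩)) = w (Quot.mk _ (Sum.inr ⟨j, d⟩))
        · rw [hwi, hwi] at hwd
          have hcd : c ≠ d := fun h => hne (by rw [h])
          obtain ⟨m, hm⟩ : ∃ m, c.1 m ≠ d.1 m := by
            by_contra! h
            exact hcd (Subtype.ext (by ext m; exact h m))
          obtain ⟨w', -, hwi', -⟩ := AttachCells.exists_extension_zero f j
            ⟨fun d : Cell n => (1 - ‖d.1‖) * d.1 m, by fun_prop⟩ (fun d hd => by simp [hd])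
          refine ⟨w', fun h => ?_⟩
          rw [hwi', hwi'] at h
          simp only [ContinuousMap.coe_mk] at h hwd
          rw [hwd] at h
          exact hm (mul_left_cancel₀ (sub_pos.mpr hd).ne' h)
        · exact ⟨w, hwd⟩
      · exact ⟨w, by rwa [hwj j d hji]⟩
  intro x y hxy
  rcases hrep x with ⟨a, rfl⟩ | ⟨i, c, hc, rfl⟩
  · rcases hrep y with ⟨b, rfl⟩ | ⟨j, d, hd, rfl⟩
    · obtain ⟨u, hu⟩ := hX.2 a b fun h => hxy (by rw [h])
      obtain ⟨w, hw⟩ := AttachCells.exists_extension f u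
      exact ⟨w, by rwa [hw, hw]⟩
    · obtain ⟨u, hu⟩ := hsep j d hd _ hxy.symm
      exact ⟨u, hu.symm⟩
  · exact hsep i c hc y hxy

lemma IsFiniteCWAtMost.isCompactSeparated {n : ℕ} {X : Type} [TopologicalSpace X]
    (hX : IsFiniteCWAtMost n X) : IsCompactSeparated X := by
  induction hX with
  | base k f => exact IsCompactSeparated.attachCells ⟨inferInstance, fun x => x.elim⟩ f
  | up _ ih => exact ih
  | attach _ k f ih => exact ih.attachCells f
  | homeo _ e ih =>
    have := ih.1
    refine ⟨e.compactSpace, fun x y hxy => ?_⟩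
    obtain ⟨u, hu⟩ := ih.2 (e.symm x) (e.symm y) (by simpa using hxy)
    exact ⟨u.comp ⟨e.symm, e.symm.continuous⟩, hu⟩

/-- A fixed point free involution of a compact space with enough functions admits an odd map to
some `ℝ^n` that stays away from the origin. -/
lemma IsCompactSeparated.exists_odd_map {X : Type*} [TopologicalSpace X]
    (hX : IsCompactSeparated X) {g : X → X} (hg : Continuous g) (hgg : ∀ x, g (g x) = x)
    (hfix : ∀ x, g x ≠ x) :
    ∃ (s : Finset X) (F : X → s → ℝ), Continuous F ∧ (∀ x, F (g x) = -F x) ∧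
      ∀ x, ∃ i, 1 ≤ |F x i| := by
  have := hX.1
  choose u hu using fun x => hX.2 (g x) x (hfix x)
  let v (x y : X) : ℝ := 2 * (u x (g y) - u x y) / (u x (g x) - u x x)
  have hv (x : X) : Continuous (v x) := by
    have := (u x).continuous
    fun_prop
  have hvx (x : X) : v x x = 2 := by
    have := sub_ne_zero.mpr (hu x)
    simp only [v]
    field_simp
  obtain ⟨s, hs⟩ := isCompact_univ.elim_finite_subcover (fun x => {y | 1 < v x y})
    (fun x => isOpen_lt continuous_const (hv x))
    (fun x _ => Set.mem_iUnion.mpr ⟨x, by simp [hvx]⟩)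
  refine ⟨s, fun y i => v i y, continuous_pi fun i => hv i, fun x => ?_, fun x => ?_⟩
  · ext i
    simp only [v, hgg, Pi.neg_apply]
    ring
  · obtain ⟨i, hi, h⟩ := Set.mem_iUnion₂.mp (hs (Set.mem_univ x))
    exact ⟨⟨i, hi⟩, (le_of_lt h).trans (le_abs_self _)⟩

/-- Augmented ordered chains of `Y` with coefficients in `ℤ/2`: formal sums of words in `Y`, a
word of length `n + 1` being an ordered `n`-simplex and the empty word the augmentation. -/
abbrev OrdChain (Y : Type*) : Type _ := List Y →₀ ZMod 2

namespace OrdChain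

variable {Y : Type*}

lemma add_self_eq_zero (c : OrdChain Y) : c + c = 0 := by
  ext l
  exact CharTwo.add_self_eq_zero _

/-- Prepend a vertex to every simplex. -/
noncomputable def cons (v : Y) : OrdChain Y →ₗ[ZMod 2] OrdChain Y :=
  Finsupp.lmapDomain _ _ (List.cons v)

/-- Push a chain forward along a map of vertices. -/
noncomputable def map (f : Y → Y) : OrdChain Y →ₗ[ZMod 2] OrdChain Y :=
  Finsupp.lmapDomain _ _ (List.map f)

/-- The boundary of a single simplex: the sum of its faces. -/
noncomputable def bdryWord : List Y → OrdChain Y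
  | [] => 0
  | v :: l => Finsupp.single l 1 + cons v (bdryWord l)

/-- The boundary operator. -/
noncomputable def bdry : OrdChain Y →ₗ[ZMod 2] OrdChain Y :=
  Finsupp.linearCombination _ bdryWord

/-- The prism over a single simplex, between its images under `a` and `b`. -/
noncomputable def prismWord (a b : Y → Y) : List Y → OrdChain Y
  | [] => 0
  | v :: l => Finsupp.single (a v :: b v :: l.map b) 1 + cons (a v) (prismWord a b l)

/-- The prism operator between the maps induced by `a` and `b`. -/
noncomputable def prism (a b : Y → Y) : OrdChain Y →ₗ[ZMod 2] OrdChain Y :=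
  Finsupp.linearCombination _ (prismWord a b)

@[simp] lemma cons_single (v : Y) (l : List Y) (r : ZMod 2) :
    cons v (Finsupp.single l r) = Finsupp.single (v :: l) r := by simp [cons]

@[simp] lemma map_single (f : Y → Y) (l : List Y) (r : ZMod 2) :
    map f (Finsupp.single l r) = Finsupp.single (l.map f) r := by simp [map]

@[simp] lemma bdry_single (l : List Y) : bdry (Finsupp.single l 1) = bdryWord l := by simp [bdry]

@[simp] lemma prism_single (a b : Y → Y) (l : List Y) :
    prism a b (Finsupp.single l 1) = prismWord a b l := by simp [prism]

lemma hom_ext {M : Type*} [AddCommGroup M] [Module (ZMod 2) M]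
    {f g : OrdChain Y →ₗ[ZMod 2] M}
    (h : ∀ l, f (Finsupp.single l 1) = g (Finsupp.single l 1)) (c : OrdChain Y) : f c = g c := by
  have : f = g := Finsupp.lhom_ext' fun l => LinearMap.ext_ring (by simpa using h l)
  rw [this]

lemma bdry_cons (v : Y) (c : OrdChain Y) : bdry (cons v c) = c + cons v (bdry c) :=
  hom_ext (f := bdry ∘ₗ cons v) (g := LinearMap.id + cons v ∘ₗ bdry)
    (fun l => by simp [bdryWord]) c

lemma bdry_bdry (c : OrdChain Y) : bdry (bdry c) = 0 := by
  refine hom_ext (f := bdry ∘ₗ bdry) (g := 0) (fun l => ?_) c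
  induction l with
  | nil => simp [bdryWord]
  | cons v l ih =>
    simp only [LinearMap.comp_apply, bdry_single, LinearMap.zero_apply] at ih
    simp [bdryWord, bdry_cons, ih, add_self_eq_zero]

lemma map_cons (f : Y → Y) (v : Y) (c : OrdChain Y) : map f (cons v c) = cons (f v) (map f c) :=
  hom_ext (f := map f ∘ₗ cons v) (g := cons (f v) ∘ₗ map f) (fun l => by simp) c

lemma bdry_map (f : Y → Y) (c : OrdChain Y) : bdry (map f c) = map f (bdry c) := by
  refine hom_ext (f := bdry ∘ₗ map f) (g := map f ∘ₗ bdry) (fun l => ?_) c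
  induction l with
  | nil => simp [bdryWord]
  | cons v l ih =>
    simp only [LinearMap.comp_apply, bdry_single, map_single] at ih
    simp [bdryWord, map_cons, ih]

lemma map_map (f g : Y → Y) (c : OrdChain Y) : map f (map g c) = map (f ∘ g) c :=
  hom_ext (f := map f ∘ₗ map g) (g := map (f ∘ g)) (fun l => by simp) c

lemma map_id (c : OrdChain Y) : map id c = c :=
  hom_ext (f := map id) (g := LinearMap.id) (fun l => by simp) c

lemma bdry_prism (a b : Y → Y) (c : OrdChain Y) :
    bdry (prism a b c) + prism a b (bdry c) = map a c + map b c := by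
  refine hom_ext (f := bdry ∘ₗ prism a b + prism a b ∘ₗ bdry) (g := map a + map b)
    (fun l => ?_) c
  have prism_cons (v : Y) (c : OrdChain Y) :
      prism a b (cons v c) = cons (a v) (cons (b v) (map b c)) + cons (a v) (prism a b c) :=
    hom_ext (f := prism a b ∘ₗ cons v)
      (g := cons (a v) ∘ₗ cons (b v) ∘ₗ map b + cons (a v) ∘ₗ prism a b)
      (fun l => by simp [prismWord]) c
  induction l with
  | nil => simp [bdryWord, prismWord, add_self_eq_zero]
  | cons v l ih =>
    simp only [LinearMap.add_apply, LinearMap.comp_apply, bdry_single, prism_single,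
      map_single] at ih ⊢
    have hb := bdry_map b (Finsupp.single l 1)
    simp only [map_single, bdry_single] at hb
    have ih' := congrArg (cons (a v)) ih
    simp only [map_add, cons_single] at ih'
    simp only [prismWord, bdryWord, map_add, bdry_single, prism_single, bdry_cons, prism_cons,
      List.map_cons, cons_single, hb]
    have h1 := add_self_eq_zero (cons (a v) (cons (b v) (map b (bdryWord l))))
    have h2 := add_self_eq_zero (prismWord a b l)
    have h3 := add_self_eq_zero (Finsupp.single (a v :: List.map b l) (1 : ZMod 2))
    linear_combination (norm := abel) ih' + h1 + h2 + h3

/-- The chains all of whose simplices have all their pairs of vertices in `W`. -/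
noncomputable def small (W : Set (Y × Y)) : Submodule (ZMod 2) (OrdChain Y) :=
  Finsupp.supported _ _ {l | ∀ a ∈ l, ∀ b ∈ l, (a, b) ∈ W}

lemma support_prismWord (a b : Y → Y) (l : List Y) :
    prismWord a b l ∈ Finsupp.supported (ZMod 2) (ZMod 2)
      {l' : List Y | ∀ x ∈ l', ∃ y ∈ l, x = a y ∨ x = b y} := by
  induction l with
  | nil => simp [prismWord]
  | cons v l ih =>
    refine Submodule.add_mem _ (Finsupp.single_mem_supported _ _ ?_) ?_
    · simp only [Set.mem_ofPred_eq, List.mem_cons, List.mem_map]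
      rintro x (rfl | rfl | ⟨y, hy, rfl⟩)
      · exact ⟨v, .inl rfl, .inl rfl⟩
      · exact ⟨v, .inl rfl, .inr rfl⟩
      · exact ⟨y, .inr hy, .inr rfl⟩
    · rw [Finsupp.mem_supported] at ih ⊢
      intro l' hl'
      classical
      obtain ⟨l'', h, rfl⟩ := Finset.mem_image.mp (Finsupp.mapDomain_support hl')
      intro x hx
      rcases List.mem_cons.mp hx with rfl | hx
      · exact ⟨v, by simp, .inl rfl⟩
      · obtain ⟨y, hy, h'⟩ := ih h x hx
        exact ⟨y, by simp [hy], h'⟩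

lemma prism_mem_small {W : Set (Y × Y)} {a b : Y → Y} {c : OrdChain Y}
    (h : ∀ l ∈ c.support, ∀ x ∈ l, ∀ y ∈ l,
      (a x, a y) ∈ W ∧ (a x, b y) ∈ W ∧ (b x, a y) ∈ W ∧ (b x, b y) ∈ W) :
    prism a b c ∈ small W := by
  rw [prism, Finsupp.linearCombination_apply]
  refine Submodule.sum_mem _ fun l hl => Submodule.smul_mem _ _ ?_
  refine Finsupp.supported_mono ?_ (support_prismWord a b l)
  intro l' hl' x hx y hy
  obtain ⟨x, hxl, rfl | rfl⟩ := hl' x hx <;> obtain ⟨y, hyl, rfl | rfl⟩ := hl' y hy <;>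
    have := h l hl x hxl y hyl <;> tauto

lemma map_mem_small {W : Set (Y × Y)} {f : Y → Y} {c : OrdChain Y}
    (h : ∀ l ∈ c.support, ∀ x ∈ l, ∀ y ∈ l, (f x, f y) ∈ W) : map f c ∈ small W := by
  intro l hl
  classical
  obtain ⟨l', h', rfl⟩ := Finset.mem_image.mp (Finsupp.mapDomain_support hl)
  simp only [List.mem_map, Set.mem_ofPred_eq]
  rintro _ ⟨x, hx, rfl⟩ _ ⟨y, hy, rfl⟩
  exact h l' h' x hx y hy

/-- In a contractible space, every sufficiently small cycle is the boundary of a small chain. -/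
lemma exists_bdry_eq [TopologicalSpace Y] (C : C(unitInterval × Y, Y)) (p : Y)
    (hC0 : ∀ y, C (0, y) = y) (hC1 : ∀ y, C (1, y) = p)
    {W : Set (Y × Y)} (hW : IsOpen W) (hdiag : ∀ y, (y, y) ∈ W) :
    ∃ W' : Set (Y × Y), IsOpen W' ∧ (∀ y, (y, y) ∈ W') ∧
      ∀ z ∈ small W', bdry z = 0 → ∃ e ∈ small W, bdry e = z := by
  let W' : Set (Y × Y) := {q | ∀ s, (C (s, q.1), C (s, q.2)) ∈ W}
  refine ⟨W', ?_, fun y s => hdiag _, fun z hz hbz => ?_⟩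
  · have hcl : IsClosed {q : unitInterval × (Y × Y) | (C (q.1, q.2.1), C (q.1, q.2.2)) ∈ W}ᶜ :=
      (hW.preimage (by fun_prop)).isClosed_compl
    have := (isClosedMap_snd_of_compactSpace _ hcl).isOpen_compl
    convert this using 1
    ext q
    simp [W']
  · have key : ∀ s s' : unitInterval, ∃ e ∈ small W,
        bdry e = map (fun y => C (s, y)) z + map (fun y => C (s', y)) z := by
      intro s s'
      let R (s s' : unitInterval) : Prop := ∃ e ∈ small W,
        bdry e = map (fun y => C (s, y)) z + map (fun y => C (s', y)) z
      have hsymm : Std.Symm R := ⟨fun a b ⟨e, he, h⟩ => ⟨e, he, by rw [h, add_comm]⟩⟩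
      refine PreconnectedSpace.induction₂ R ?_ ⟨?_⟩ s s'
      · intro s
        have hev : ∀ᶠ s' in nhds s, ∀ l ∈ z.support, ∀ x ∈ l, ∀ y ∈ l,
            (C (s, x), C (s', y)) ∈ W ∧ (C (s', x), C (s, y)) ∈ W := by
          classical
          rw [Filter.eventually_all_finset]
          intro l hl
          simp only [← List.mem_toFinset (l := l)]
          rw [Filter.eventually_all_finset]
          intro x hx
          rw [Filter.eventually_all_finset]
          intro y hy
          have hxy := hz hl x (by simpa using hx) y (by simpa using hy) s
          refine Filter.Eventually.and ?_ ?_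
          · have hc : Continuous fun s' => (C (s, x), C (s', y)) := by fun_prop
            exact hc.continuousAt (hW.mem_nhds hxy)
          · have hc : Continuous fun s' => (C (s', x), C (s, y)) := by fun_prop
            exact hc.continuousAt (hW.mem_nhds hxy)
        filter_upwards [hev] with s' hs'
        refine ⟨prism (fun y => C (s, y)) (fun y => C (s', y)) z, prism_mem_small ?_, ?_⟩
        · intro l hl x hx y hy
          exact ⟨hz hl x hx y hy s, (hs' l hl x hx y hy).1, (hs' l hl x hx y hy).2,
            hz hl x hx y hy s'⟩
        · simpa [hbz] using bdry_prism (fun y => C (s, y)) (fun y => C (s', y)) z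
      · rintro a b c ⟨e, he, h⟩ ⟨e', he', h'⟩
        refine ⟨e + e', Submodule.add_mem _ he he', ?_⟩
        rw [map_add, h, h']
        linear_combination (norm := abel) add_self_eq_zero (map (fun y => C (b, y)) z)
    obtain ⟨e, he, h⟩ := key 0 1
    have h0 : (fun y => C (0, y)) = id := funext hC0
    have h1 : (fun y => C (1, y)) = fun _ => p := funext hC1
    rw [h0, h1, map_id] at h
    refine ⟨e + cons p (map (fun _ => p) z), Submodule.add_mem _ he ?_, ?_⟩
    · intro l hl
      classical
      obtain ⟨l', h', rfl⟩ := Finset.mem_image.mp (Finsupp.mapDomain_support hl)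
      obtain ⟨l'', h'', rfl⟩ := Finset.mem_image.mp (Finsupp.mapDomain_support h')
      have hp : ∀ a ∈ p :: List.map (fun _ => p) l'', a = p := by
        simp only [List.mem_cons, List.mem_map]
        rintro a (rfl | ⟨_, _, rfl⟩) <;> rfl
      intro a ha b hb
      rw [hp a ha, hp b hb]
      exact hdiag p
    · rw [map_add, h, bdry_cons, bdry_map, hbz, map_zero, map_zero, add_zero]
      linear_combination (norm := abel) add_self_eq_zero (map (fun _ => p) z)

/-- `IsTower t p j c` says that `c` is the top chain of a sequence `c₀ = p, c₁, …, c_j = c`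
with `∂ cᵢ₊₁ = cᵢ + t cᵢ`, the algebraic shadow of an equivariant map from `S^j`. -/
def IsTower (t : Y → Y) (p : Y) : ℕ → OrdChain Y → Prop
  | 0, c => c = Finsupp.single [p] 1
  | j + 1, c => ∃ c', IsTower t p j c' ∧ bdry c = c' + map t c'

lemma exists_isTower [TopologicalSpace Y] (C : C(unitInterval × Y, Y)) (p : Y)
    (hC0 : ∀ y, C (0, y) = y) (hC1 : ∀ y, C (1, y) = p)
    {t : Y → Y} (ht : Continuous t) (htt : ∀ y, t (t y) = y) (j : ℕ)
    {W : Set (Y × Y)} (hW : IsOpen W) (hdiag : ∀ y, (y, y) ∈ W) :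
    ∃ c ∈ small W, IsTower t p j c := by
  induction j generalizing W with
  | zero =>
    refine ⟨_, ?_, rfl⟩
    refine Finsupp.single_mem_supported _ _ ?_
    simp [hdiag]
  | succ j ih =>
    obtain ⟨W', hW', hd', H⟩ := exists_bdry_eq C p hC0 hC1 hW hdiag
    obtain ⟨c, hc, hcT⟩ := @ih (W' ∩ Prod.map t t ⁻¹' W')
      (hW'.inter (hW'.preimage (ht.prodMap ht))) (fun y => ⟨hd' y, hd' (t y)⟩)
    have hcyc : bdry (c + map t c) = 0 := by
      rw [map_add, bdry_map]
      cases j with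
      | zero =>
        obtain rfl : c = _ := hcT
        simp [bdryWord, add_self_eq_zero]
      | succ j =>
        obtain ⟨c', -, h⟩ := hcT
        have : t ∘ t = id := funext htt
        rw [h, map_add, map_map, this, map_id, add_comm (map t c'), add_self_eq_zero]
    obtain ⟨e, he, heq⟩ := H (c + map t c) (Submodule.add_mem _
      (fun l hl a ha b hb => (hc hl a ha b hb).1)
      (map_mem_small fun l hl a ha b hb => (hc hl a ha b hb).2)) hcyc
    exact ⟨e, he, c, hcT, heq⟩

/-- The value on a simplex of the cup product of the coboundaries of the given `0`-cochains. -/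
def cup : List (Y → ZMod 2) → List Y → ZMod 2
  | [], [_] => 1
  | s :: ss, v :: w :: l => (s v + s w) * cup ss (w :: l)
  | _, _ => 0

/-- The cup product of coboundaries of `0`-cochains, as a linear functional on chains. -/
noncomputable def cupHom (ss : List (Y → ZMod 2)) : OrdChain Y →ₗ[ZMod 2] ZMod 2 :=
  Finsupp.linearCombination _ (cup ss)

@[simp] lemma cupHom_single (ss : List (Y → ZMod 2)) (l : List Y) :
    cupHom ss (Finsupp.single l 1) = cup ss l := by simp [cupHom]

/-- The cup product of the `0`-cochain `s` with a product of coboundaries. -/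
noncomputable def cochainCupHom (s : Y → ZMod 2) (ss : List (Y → ZMod 2)) :
    OrdChain Y →ₗ[ZMod 2] ZMod 2 :=
  Finsupp.linearCombination _ fun l => (l.head?.elim 0 s) * cup ss l

@[simp] lemma cochainCupHom_single (s : Y → ZMod 2) (ss : List (Y → ZMod 2)) (l : List Y) :
    cochainCupHom s ss (Finsupp.single l 1) = (l.head?.elim 0 s) * cup ss l := by
  simp [cochainCupHom]

lemma cup_cons_of_cupHom_bdry (s : Y → ZMod 2) (ss : List (Y → ZMod 2))
    (h : ∀ c, cupHom ss (bdry c) = 0) (c : OrdChain Y) :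
    cupHom (s :: ss) c = cochainCupHom s ss (bdry c) := by
  refine hom_ext (f := cupHom (s :: ss)) (g := cochainCupHom s ss ∘ₗ bdry) (fun l => ?_) c
  simp only [cupHom_single, LinearMap.comp_apply, bdry_single]
  match l with
  | [] => simp [cup, bdryWord]
  | [v] => simp [cup, bdryWord]
  | v :: w :: l =>
    have hc (x : OrdChain Y) :
        cochainCupHom s ss (cons v x) = s v * cupHom ss (cons v x) :=
      hom_ext (f := cochainCupHom s ss ∘ₗ cons v) (g := s v • (cupHom ss ∘ₗ cons v))
        (fun l => by simp) x
    have hb := h (Finsupp.single (v :: w :: l) 1)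
    simp only [bdry_single, bdryWord, map_add, cons_single, cupHom_single] at hb
    simp only [bdryWord, map_add, cochainCupHom_single, cons_single, hc, cup, List.head?_cons,
      Option.elim_some]
    have h2 := CharTwo.add_self_eq_zero (s v * cup ss (w :: l))
    linear_combination (-s v) * hb + h2

lemma cupHom_bdry (ss : List (Y → ZMod 2)) (c : OrdChain Y) : cupHom ss (bdry c) = 0 := by
  induction ss generalizing c with
  | nil =>
    refine hom_ext (f := cupHom [] ∘ₗ bdry) (g := 0) (fun l => ?_) c
    simp only [LinearMap.comp_apply, bdry_single]
    match l with
    | [] => simp [bdryWord]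
    | [v] => simp [bdryWord, cup]
    | [v, w] =>
      simp [bdryWord, cup]
      exact CharTwo.add_self_eq_zero _
    | v :: w :: x :: l =>
      have hc (y : OrdChain Y) : cupHom [] (cons v (cons w y)) = 0 :=
        hom_ext (f := cupHom [] ∘ₗ cons v ∘ₗ cons w) (g := 0) (fun l => by simp [cup]) y
      rw [bdryWord, bdryWord]
      simp [cup, hc]
  | cons s ss ih =>
    rw [cup_cons_of_cupHom_bdry s ss ih, bdry_bdry, map_zero]

lemma cup_map {t : Y → Y} {ss : List (Y → ZMod 2)} (hs : ∀ s ∈ ss, ∀ y, s (t y) = s y + 1)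
    (l : List Y) : cup ss (l.map t) = cup ss l := by
  induction ss generalizing l with
  | nil =>
    match l with
    | [] => rfl
    | [v] => rfl
    | v :: w :: l => rfl
  | cons s ss ih =>
    match l with
    | [] => rfl
    | [v] => rfl
    | v :: w :: l =>
      have := ih (fun s' h => hs s' (by simp [h])) (w :: l)
      simp only [List.map_cons] at this
      simp only [List.map_cons, cup, this, hs s (by simp)]
      have h2 : (1 : ZMod 2) + 1 = 0 := CharTwo.add_self_eq_zero _
      linear_combination cup ss (w :: l) * h2

lemma IsTower.cupHom_eq_one {t : Y → Y} {p : Y} {ss : List (Y → ZMod 2)}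
    (hs : ∀ s ∈ ss, ∀ y, s (t y) = s y + 1) {c : OrdChain Y} (hc : IsTower t p ss.length c) :
    cupHom ss c = 1 := by
  induction ss generalizing c with
  | nil =>
    obtain rfl : c = _ := hc
    simp [cup]
  | cons s ss ih =>
    obtain ⟨c', hc', h⟩ := hc
    have hs' : ∀ s' ∈ ss, ∀ y, s' (t y) = s' y + 1 := fun s' h => hs s' (by simp [h])
    rw [cup_cons_of_cupHom_bdry s ss (cupHom_bdry ss), h, ← ih hs' hc', map_add]
    refine hom_ext (f := cochainCupHom s ss + cochainCupHom s ss ∘ₗ map t) (g := cupHom ss)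
      (fun l => ?_) c'
    match l with
    | [] => cases ss <;> simp [cup]
    | v :: l =>
      have := cup_map hs' (v :: l)
      simp only [List.map_cons] at this
      simp [hs s (by simp) v, this]
      have h2 := CharTwo.add_self_eq_zero (s v)
      linear_combination cup ss (v :: l) * h2

lemma exists_ne_of_cup_ne_zero {ss : List (Y → ZMod 2)} {l : List Y} (h : cup ss l ≠ 0) :
    l ≠ [] ∧ ∀ s ∈ ss, ∃ a ∈ l, ∃ b ∈ l, s a ≠ s b := by
  induction ss generalizing l with
  | nil =>
    match l with
    | [] => simp [cup] at h
    | v :: l => simp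
  | cons s ss ih =>
    match l with
    | [] => simp [cup] at h
    | [v] => simp [cup] at h
    | v :: w :: l =>
      rw [cup] at h
      refine ⟨by simp, fun s' hs' => ?_⟩
      rcases List.mem_cons.mp hs' with rfl | hs'
      · refine ⟨v, by simp, w, by simp, fun heq => left_ne_zero_of_mul h ?_⟩
        rw [heq]
        exact CharTwo.add_self_eq_zero _
      · obtain ⟨a, ha, b, hb, hab⟩ := (ih (right_ne_zero_of_mul h)).2 s' hs'
        exact ⟨a, List.mem_cons_of_mem _ ha, b, List.mem_cons_of_mem _ hb, hab⟩

end OrdChain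

/-- A contractible space with an involution `t` carries no continuous odd map to a finite
dimensional vector space that stays away from the origin. -/
theorem false_of_odd_map_of_contraction {Y : Type*} [TopologicalSpace Y]
    (C : C(unitInterval × Y, Y)) (p : Y)
    (hC0 : ∀ y, C (0, y) = y) (hC1 : ∀ y, C (1, y) = p)
    {t : Y → Y} (ht : Continuous t) (htt : ∀ y, t (t y) = y)
    {ι : Type*} [Finite ι] {F : Y → ι → ℝ} (hF : Continuous F) (hodd : ∀ y, F (t y) = -F y)
    (hbig : ∀ y, ∃ i, 1 ≤ |F y i|) : False := by
  classical
  have : Fintype ι := Fintype.ofFinite ι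
  have : Nonempty ι := (hbig p).nonempty
  let idx (y : Y) : ι := Classical.epsilon fun j => F y j ≠ 0
  have hidx_ne (y : Y) : F y (idx y) ≠ 0 :=
    Classical.epsilon_spec (p := fun j => F y j ≠ 0) <| by
      obtain ⟨i, hi⟩ := hbig y
      exact ⟨i, fun h => by simp [h] at hi; linarith⟩
  have hidx_t (y : Y) : idx (t y) = idx y := by simp [idx, hodd]
  let s (i : ι) (y : Y) : ZMod 2 :=
    if 0 < F y i then 1 else if F y i < 0 then 0 else if 0 < F y (idx y) then 1 else 0
  have h11 : (1 : ZMod 2) + 1 = 0 := CharTwo.add_self_eq_zero _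
  have hst (i : ι) (y : Y) : s i (t y) = s i y + 1 := by
    simp only [s, hidx_t, hodd, Pi.neg_apply, Left.neg_pos_iff, Left.neg_neg_iff]
    rcases lt_trichotomy (F y i) 0 with h | h | h
    · simp [h, h.not_gt]
    · rcases (hidx_ne y).lt_or_gt with h' | h'
      · simp [h, h', h'.not_gt]
      · simp [h, h', h'.not_gt, h11]
    · simp [h, h.not_gt, h11]
  let W : Set (Y × Y) := {q | ∀ i, |F q.1 i - F q.2 i| < 1}
  have hW : IsOpen W := by
    have : W = ⋂ i, {q : Y × Y | |F q.1 i - F q.2 i| < 1} := by ext; simp [W]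
    rw [this]
    exact isOpen_iInter_of_finite fun i => isOpen_lt (by fun_prop) continuous_const
  let ss : List (Y → ZMod 2) := (Finset.univ.toList : List ι).map s
  have hss : ∀ r ∈ ss, ∀ y, r (t y) = r y + 1 := by
    simp only [ss, List.mem_map]
    rintro _ ⟨i, -, rfl⟩
    exact hst i
  obtain ⟨c, hc, hT⟩ := OrdChain.exists_isTower C p hC0 hC1 ht htt ss.length hW
    (fun y i => by simp)
  have h1 := hT.cupHom_eq_one hss
  obtain ⟨l, hl, hne⟩ : ∃ l ∈ c.support, OrdChain.cup ss l ≠ 0 := by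
    by_contra! h
    rw [OrdChain.cupHom, Finsupp.linearCombination_apply,
      Finsupp.sum, Finset.sum_eq_zero fun l hl => by rw [h l hl, smul_zero]] at h1
    exact zero_ne_one h1
  obtain ⟨hnil, hsep⟩ := OrdChain.exists_ne_of_cup_ne_zero hne
  obtain ⟨y, hy⟩ := List.exists_mem_of_ne_nil l hnil
  obtain ⟨i, hi⟩ := hbig y
  have hconst : ∀ a ∈ l, s i a = s i y := by
    intro a ha
    have hW' := abs_lt.mp (hc hl y hy a ha i)
    simp only [s]
    rcases le_abs.mp hi with h | h
    · rw [if_pos (by linarith), if_pos (by linarith)]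
    · rw [if_neg (by linarith), if_pos (by linarith), if_neg (by linarith), if_pos (by linarith)]
  obtain ⟨a, ha, b, hb, hab⟩ := hsep (s i) (List.mem_map.mpr ⟨i, by simp, rfl⟩)
  exact hab ((hconst a ha).trans (hconst b hb).symm)

/-- Commuting involutions of a nonzero lattice have a common eigenvector in the dual lattice. -/
lemma exists_common_dual_eigenvector {L ι : Type*} [AddCommGroup L] (c : ι → L →ₗ[ℤ] L)
    (hcomm : ∀ a b l, c a (c b l) = c b (c a l)) (hinv : ∀ a l, c a (c a l) = l)
    {φ₀ : L →ₗ[ℤ] ℤ} (hφ₀ : φ₀ ≠ 0) (S : Finset ι) :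
    ∃ φ : L →ₗ[ℤ] ℤ, φ ≠ 0 ∧ ∀ a ∈ S, φ ∘ₗ c a = φ ∨ φ ∘ₗ c a = -φ := by
  classical
  induction S using Finset.induction_on with
  | empty => exact ⟨φ₀, hφ₀, by simp⟩
  | insert a S _ ih =>
    obtain ⟨φ, hφ, h⟩ := ih
    by_cases h0 : φ + φ ∘ₗ c a = 0
    · refine ⟨φ, hφ, fun b hb => ?_⟩
      rcases Finset.mem_insert.mp hb with rfl | hb
      · exact .inr (eq_neg_of_add_eq_zero_right h0)
      · exact h b hb
    · refine ⟨_, h0, fun b hb => ?_⟩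
      rcases Finset.mem_insert.mp hb with rfl | hb
      · left
        ext l
        simp [hinv, add_comm]
      · refine (h b hb).imp (fun h => ?_) fun h => ?_ <;>
        · ext l
          have h1 := LinearMap.congr_fun h l
          have h2 := LinearMap.congr_fun h (c a l)
          simp only [LinearMap.comp_apply, LinearMap.neg_apply] at h1 h2
          simp only [LinearMap.comp_apply, LinearMap.neg_apply, LinearMap.add_apply,
            hcomm a b, h1, h2]
          try ring

lemma Subgroup.index_le_two_of_mul_mem {G : Type*} [Group G] (H : Subgroup G)
    (h : ∀ a b, a ∉ H → b ∉ H → a * b ∈ H) : H.index ≤ 2 := by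
  by_cases hH : ∃ a, a ∉ H
  · obtain ⟨a, ha⟩ := hH
    refine (Subgroup.index_eq_two_iff.mpr ⟨a, fun b => ?_⟩).le
    by_cases hb : b ∈ H
    · exact .inr ⟨hb, fun hba => ha ((H.mul_mem_cancel_left hb).mp hba)⟩
    · exact .inl ⟨h b a hb ha, hb⟩
  · push Not at hH
    simp [(Subgroup.eq_top_iff' H).mpr hH]

/-- The rank of a nontrivial kernel. -/
lemma finrank_ker_of_ne_zero {L : Type*} [AddCommGroup L] [Module.Free ℤ L] [Module.Finite ℤ L]
    {φ : L →ₗ[ℤ] ℤ} (hφ : φ ≠ 0) :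
    Module.finrank ℤ (LinearMap.ker φ) + 1 = Module.finrank ℤ L := by
  have h1 := Submodule.finrank_quotient_add_finrank (LinearMap.ker φ)
  rw [φ.quotKerEquivRange.finrank_eq] at h1
  have h2 : Module.finrank ℤ (LinearMap.range φ) ≤ 1 := by
    simpa using Submodule.finrank_le (LinearMap.range φ)
  have h3 : Module.finrank ℤ (LinearMap.range φ) ≠ 0 := by
    intro h
    have := Submodule.finrank_eq_zero.mp h
    exact hφ (LinearMap.range_eq_bot.mp this)
  omega

/-- A group extension of an elementary abelian `2`-group `G` by a lattice `L`, without elements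
of order two: then `|G| ≤ 2 ^ rank L`. -/
theorem card_le_two_pow_of_extension (k : ℕ) :
    ∀ {Γ G L : Type} [Group Γ] [Group G] [Finite G] [AddCommGroup L] [Module.Free ℤ L]
      [Module.Finite ℤ L] (i : L → Γ) (π : Γ →* G),
      (∀ a b, i (a + b) = i a * i b) → Function.Injective i → Function.Surjective π →
      (∀ γ, π γ = 1 ↔ ∃ l, i l = γ) → (∀ g : G, g * g = 1) → (∀ γ : Γ, γ * γ = 1 → γ = 1) →
      Module.finrank ℤ L = k → Nat.card G ≤ 2 ^ k := by
  induction k with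
  | zero =>
    intro Γ G L _ _ _ _ _ _ i π hadd hinj hsurj hex hG htf hk
    have hL : Subsingleton L := Module.finrank_zero_iff.mp hk
    have h0 : i 0 = 1 := by simpa using hadd 0 0
    have hG1 : Subsingleton G := by
      refine subsingleton_of_forall_eq 1 fun g => ?_
      obtain ⟨γ, rfl⟩ := hsurj g
      obtain ⟨l, hl⟩ := (hex (γ * γ)).mp (by rw [map_mul, hG])
      rw [htf γ (by rw [← hl, Subsingleton.elim l 0, h0]), map_one]
    simp
  | succ k ih =>
    intro Γ G L _ _ _ _ _ _ i π hadd hinj hsurj hex hG htf hk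
    have h0 : i 0 = 1 := by simpa using hadd 0 0
    have hGc (g h : G) : g * h = h * g := by
      have e1 : g⁻¹ = g := inv_eq_of_mul_eq_one_left (hG g)
      have e2 : h⁻¹ = h := inv_eq_of_mul_eq_one_left (hG h)
      have e3 : (g * h)⁻¹ = g * h := inv_eq_of_mul_eq_one_left (hG (g * h))
      rw [← e3, mul_inv_rev, e1, e2]
    have hπi (l : L) : π (i l) = 1 := (hex _).mpr ⟨l, rfl⟩
    have hconj (γ : Γ) (l : L) : ∃ l', i l' = γ * i l * γ⁻¹ :=
      (hex _).mp (by simp [hπi])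
    choose c' hc' using hconj
    have hc_add (γ : Γ) (a b : L) : c' γ (a + b) = c' γ a + c' γ b := by
      apply hinj
      rw [hc', hadd, hadd, hc', hc']
      group
    let c (γ : Γ) : L →ₗ[ℤ] L := (AddMonoidHom.mk' (c' γ) (hc_add γ)).toIntLinearMap
    have hc (γ : Γ) (l : L) : i (c γ l) = γ * i l * γ⁻¹ := hc' γ l
    have hi_comm (a b : L) : i a * i b = i b * i a := by rw [← hadd, add_comm, hadd]
    have hc_i (a l : L) : c (i a) l = l := hinj (by rw [hc, hi_comm, mul_inv_cancel_right])
    have hc_mul (γ δ : Γ) (l : L) : c (γ * δ) l = c γ (c δ l) := by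
      apply hinj
      simp only [hc]
      group
    have hc_eq (γ δ : Γ) (h : π γ = π δ) : c γ = c δ := by
      obtain ⟨m, hm⟩ := (hex (δ⁻¹ * γ)).mp (by simp [h])
      ext l
      rw [← mul_inv_cancel_left δ γ, hc_mul, ← hm, hc_i]
    have hsq (γ : Γ) : ∃ l, i l = γ * γ := (hex _).mp (by simp [hG])
    choose sq hsq using hsq
    obtain ⟨φ₀, hφ₀⟩ : ∃ φ₀ : L →ₗ[ℤ] ℤ, φ₀ ≠ 0 := by
      let b := Module.finBasis ℤ L
      let j : Fin (Module.finrank ℤ L) := ⟨0, by omega⟩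
      refine ⟨b.coord j, fun h => ?_⟩
      have := LinearMap.congr_fun h (b j)
      simp at this
    choose r hr using hsurj
    have : Fintype G := Fintype.ofFinite G
    obtain ⟨φ, hφ, hφS⟩ := exists_common_dual_eigenvector (fun g => c (r g))
      (fun g h l => by
        rw [← hc_mul, ← hc_mul, hc_eq (r g * r h) (r h * r g) (by simp [hr, hGc])])
      (fun g l => by
        rw [← hc_mul, hc_eq (r g * r g) (i 0) (by rw [hπi, map_mul, hG]), hc_i])
      hφ₀ Finset.univ
    have heig (γ : Γ) : (∀ l, φ (c γ l) = φ l) ∨ ∀ l, φ (c γ l) = -φ l := by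
      rw [← hc_eq (r (π γ)) γ (hr _)]
      exact (hφS (π γ) (Finset.mem_univ _)).imp (fun h l => LinearMap.congr_fun h l)
        (fun h l => LinearMap.congr_fun h l)
    obtain ⟨l₀, hl₀⟩ : ∃ l, φ l ≠ 0 := by
      by_contra! h
      exact hφ (LinearMap.ext h)
    /- The elements acting trivially on the quotient line, and the square map on them. -/
    let Γ₀ : Subgroup Γ :=
      { carrier := {γ | ∀ l, φ (c γ l) = φ l}
        one_mem' := fun l => by rw [← h0, hc_i]
        mul_mem' := fun {a b} ha hb l => by rw [hc_mul, ha, hb]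
        inv_mem' := fun {a} ha l => by
          rw [← ha (c a⁻¹ l), ← hc_mul, mul_inv_cancel, ← h0, hc_i] }
    have hΓ₀ (γ : Γ) : γ ∈ Γ₀ ↔ ∀ l, φ (c γ l) = φ l := Iff.rfl
    have hi_mem (l : L) : i l ∈ Γ₀ := fun m => by rw [hc_i]
    have hsq_i (l : L) : sq (i l) = l + l := hinj (by rw [hsq, hadd])
    have hsq_conj (γ δ : Γ) : sq (γ * δ * γ⁻¹) = c γ (sq δ) := by
      apply hinj
      rw [hsq, hc, hsq]
      group
    have hsq_mul {γ δ : Γ} (hγ : γ ∈ Γ₀) (hδ : δ ∈ Γ₀) :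
        φ (sq (γ * δ)) = φ (sq γ) + φ (sq δ) := by
      obtain ⟨κ, hκ⟩ := (hex (γ⁻¹ * δ * γ * δ⁻¹)).mp (by
        simp only [map_mul, map_inv]
        rw [hGc _ (π δ)]
        group)
      have e1 : sq (γ * δ) = sq γ + κ + sq δ := by
        apply hinj
        simp only [hadd, hsq, hκ]
        group
      have e2 : c γ⁻¹ (sq δ) = κ + c δ κ + sq δ := by
        apply hinj
        simp only [hadd, hsq, hc, hκ]
        group
      have e3 := congrArg φ e2
      rw [map_add, map_add, (hΓ₀ _).mp (Γ₀.inv_mem hγ), (hΓ₀ _).mp hδ] at e3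
      rw [e1, map_add, map_add]
      omega
    let K : Subgroup Γ :=
      { carrier := {γ | γ ∈ Γ₀ ∧ φ (sq γ) = 0}
        one_mem' := ⟨Γ₀.one_mem, by rw [← h0, hsq_i, add_zero, map_zero]⟩
        mul_mem' := fun {a b} ha hb =>
          ⟨Γ₀.mul_mem ha.1 hb.1, by rw [hsq_mul ha.1 hb.1, ha.2, hb.2, add_zero]⟩
        inv_mem' := fun {a} ha => by
          refine ⟨Γ₀.inv_mem ha.1, ?_⟩
          have := hsq_mul ha.1 (Γ₀.inv_mem ha.1)
          rw [mul_inv_cancel, ← h0, hsq_i, add_zero, map_zero, ha.2, zero_add] at this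
          exact this.symm }
    have hK (γ : Γ) : γ ∈ K ↔ γ ∈ Γ₀ ∧ φ (sq γ) = 0 := Iff.rfl
    have hKnormal : K.Normal := by
      refine ⟨fun x hx γ => ⟨fun l => ?_, ?_⟩⟩
      · rw [hc_eq (γ * x * γ⁻¹) x (by simp only [map_mul, map_inv]; rw [hGc (π γ)]; group)]
        exact hx.1 l
      · rw [hsq_conj]
        rcases heig γ with h | h <;> rw [h, hx.2]
        exact neg_zero
    have hiK (l : L) : i l ∈ K ↔ φ l = 0 := by
      rw [hK, hsq_i, map_add]
      exact ⟨fun h => by have := h.2; omega, fun h => ⟨hi_mem l, by omega⟩⟩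
    /- An element generating `Γ` together with `Γ₀`, trivial if `Γ₀ = Γ`. -/
    obtain ⟨γ₁, h₁K, h₁, h₁'⟩ : ∃ γ₁ : Γ, γ₁ * γ₁ ∈ K ∧ (∀ γ, γ ∈ Γ₀ ∨ γ₁ * γ ∈ Γ₀) ∧
        (γ₁ ∈ Γ₀ → γ₁ = 1) := by
      by_cases h : ∃ γ, γ ∉ Γ₀
      · obtain ⟨γ₁, h₁⟩ := h
        have hneg (γ) (hγ : γ ∉ Γ₀) (l : L) : φ (c γ l) = -φ l := (heig γ).resolve_left hγ l
        refine ⟨γ₁, ?_, fun γ => ?_, fun h => absurd h h₁⟩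
        · rw [← hsq, hiK]
          have e : c γ₁ (sq γ₁) = sq γ₁ := by
            apply hinj
            rw [hc, hsq]
            group
          have := hneg γ₁ h₁ (sq γ₁)
          rw [e] at this
          omega
        · refine or_iff_not_imp_left.mpr fun hγ l => ?_
          rw [hc_mul, hneg _ h₁, hneg _ hγ, neg_neg]
      · push Not at h
        exact ⟨1, by simp, fun γ => .inl (h γ), fun _ => rfl⟩
    let q : Γ →* Γ ⧸ K := QuotientGroup.mk' K
    have hq (γ : Γ) : q γ = 1 ↔ γ ∈ K := QuotientGroup.eq_one_iff γ
    have hq₁ : q γ₁ * q γ₁ = 1 := by rw [← map_mul, hq]; exact h₁K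
    let Γ' : Subgroup Γ := (Subgroup.zpowers (q γ₁)).comap q
    have hKΓ' {γ : Γ} (h : γ ∈ K) : γ ∈ Γ' := by
      rw [Subgroup.mem_comap, (hq γ).mpr h]
      exact Subgroup.one_mem _
    have h₁Γ' : γ₁ ∈ Γ' := Subgroup.mem_zpowers _
    have hΓ' {γ : Γ} (h : γ ∈ Γ') : γ ∈ K ∨ γ₁ * γ ∈ K := by
      obtain ⟨n, hn⟩ := Subgroup.mem_zpowers_iff.mp h
      rw [← hq, ← hq, map_mul, ← hn]
      rcases Int.even_or_odd' n with ⟨m, rfl | rfl⟩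
      · left
        rw [zpow_mul, zpow_two, hq₁, one_zpow]
      · right
        rw [zpow_add, zpow_mul, zpow_two, hq₁, one_zpow, one_mul, zpow_one, hq₁]
    have hiΓ' (l : L) : i l ∈ Γ' ↔ φ l = 0 := by
      refine ⟨fun h => ?_, fun h => hKΓ' ((hiK l).mpr h)⟩
      rcases hΓ' h with h | h
      · exact (hiK l).mp h
      · have := h₁' ((Γ₀.mul_mem_cancel_right (hi_mem l)).mp h.1)
        rw [this, one_mul] at h
        exact (hiK l).mp h
    let π' : Γ' →* G := π.comp Γ'.subtype
    have hcard : Nat.card π'.range ≤ 2 ^ k := by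
      refine ih (L := LinearMap.ker φ) (fun l => ⟨i l, (hiΓ' _).mpr l.2⟩) π'.rangeRestrict
        (fun a b => Subtype.ext (hadd a b))
        (fun a b h => Subtype.ext (hinj (congrArg Subtype.val h)))
        π'.rangeRestrict_surjective (fun γ => ?_) (fun g => Subtype.ext (hG g))
        (fun γ h => Subtype.ext (htf γ (congrArg Subtype.val h))) ?_
      · rw [← Subtype.coe_inj]
        refine (hex γ).trans ⟨fun ⟨l, hl⟩ => ?_, fun ⟨l, hl⟩ => ⟨l, congrArg Subtype.val hl⟩⟩
        exact ⟨⟨l, (hiΓ' l).mp (by rw [hl]; exact γ.2)⟩, Subtype.ext hl⟩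
      · have := finrank_ker_of_ne_zero hφ
        omega
    /- Membership in `π(Γ')` is detected by a parity. -/
    obtain ⟨d, hd⟩ := (Submodule.IsPrincipal.principal (LinearMap.range φ))
    have hd_mem (l : L) : ∃ n : ℤ, φ l = n * d := by
      have : φ l ∈ LinearMap.range φ := ⟨l, rfl⟩
      rw [hd, Submodule.mem_span_singleton] at this
      obtain ⟨n, hn⟩ := this
      exact ⟨n, by rw [← hn, smul_eq_mul]⟩
    obtain ⟨ld, hld⟩ : ∃ l, φ l = d := by
      have : d ∈ LinearMap.range φ := by rw [hd]; exact Submodule.mem_span_singleton_self d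
      exact this
    have hrange {γ : Γ} (hγ : γ ∈ Γ₀) {n : ℤ} (hn : φ (sq γ) = 2 * n * d) : π γ ∈ π'.range := by
      refine ⟨⟨γ * i (-n • ld), hKΓ' ⟨Γ₀.mul_mem hγ (hi_mem _), ?_⟩⟩, ?_⟩
      · rw [hsq_mul hγ (hi_mem _), hsq_i, hn, map_add, map_zsmul, hld, smul_eq_mul]
        ring
      · simp [π', hπi]
    have hrange₁ : π γ₁ ∈ π'.range := ⟨⟨γ₁, h₁Γ'⟩, rfl⟩
    have hodd (g : G) (hg : g ∉ π'.range) : ∃ γ ∈ Γ₀, (π γ = g ∨ π γ = π γ₁ * g) ∧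
        ∃ n, φ (sq γ) = (2 * n + 1) * d := by
      obtain ⟨γ, hγ, hπγ⟩ : ∃ γ ∈ Γ₀, π γ = g ∨ π γ = π γ₁ * g := by
        rcases h₁ (r g) with h | h
        · exact ⟨_, h, .inl (hr g)⟩
        · exact ⟨_, h, .inr (by rw [map_mul, hr])⟩
      refine ⟨γ, hγ, hπγ, ?_⟩
      obtain ⟨m, hm⟩ := hd_mem (sq γ)
      rcases Int.even_or_odd' m with ⟨n, rfl | rfl⟩
      · exfalso
        have := hrange hγ hm
        rcases hπγ with h | h
        · exact hg (h ▸ this)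
        · rw [h] at this
          exact hg ((Subgroup.mul_mem_cancel_left _ hrange₁).mp this)
      · exact ⟨n, hm⟩
    have hindex : π'.range.index ≤ 2 := by
      refine Subgroup.index_le_two_of_mul_mem _ fun g h hg hh => ?_
      obtain ⟨γ, hγ, hπγ, n, hn⟩ := hodd g hg
      obtain ⟨δ, hδ, hπδ, m, hm⟩ := hodd h hh
      have hmem := hrange (Γ₀.mul_mem hγ hδ) (n := n + m + 1) (by
        rw [hsq_mul hγ hδ, hn, hm]
        ring)
      rw [map_mul] at hmem
      rcases hπγ with e | e <;> rcases hπδ with e' | e' <;> rw [e, e'] at hmem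
      · exact hmem
      · rw [← mul_assoc, hGc g, mul_assoc] at hmem
        exact (Subgroup.mul_mem_cancel_left _ hrange₁).mp hmem
      · rw [mul_assoc] at hmem
        exact (Subgroup.mul_mem_cancel_left _ hrange₁).mp hmem
      · rwa [mul_assoc, ← mul_assoc g, hGc g, mul_assoc, ← mul_assoc, hG, one_mul] at hmem
    rw [← π'.range.card_mul_index, pow_succ]
    exact Nat.mul_le_mul hcard hindex

namespace TorusCover

open unitInterval

variable {k : ℕ}

/-- The covering map from `ℝ^k` to the torus `(ℝ/ℤ)^k`. -/
def torusMk (v : Fin k → ℝ) : Fin k → UnitAddCircle := fun j => (v j : UnitAddCircle)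

theorem continuous_torusMk : Continuous (torusMk : (Fin k → ℝ) → _) :=
  continuous_pi fun j => (AddCircle.continuous_mk' (1 : ℝ)).comp (continuous_apply j)

theorem torusMk_surjective : Function.Surjective (torusMk : (Fin k → ℝ) → _) := fun t =>
  ⟨fun j => (QuotientAddGroup.mk_surjective (t j)).choose,
    funext fun j => (QuotientAddGroup.mk_surjective (t j)).choose_spec⟩

/-- The inclusion of `ℤ^k` in `ℝ^k`. -/
def intVec (n : Fin k → ℤ) : Fin k → ℝ := fun j => (n j : ℝ)

theorem intVec_injective : Function.Injective (intVec : (Fin k → ℤ) → _) := fun _ _ h =>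
  funext fun j => Int.cast_injective (congrFun h j)

theorem intVec_add (m n : Fin k → ℤ) : intVec (m + n) = intVec m + intVec n :=
  funext fun j => Int.cast_add (m j) (n j)

theorem torusMk_add_intVec (v : Fin k → ℝ) (n : Fin k → ℤ) :
    torusMk (v + intVec n) = torusMk v := by
  funext j
  simp only [torusMk, intVec, Pi.add_apply, AddCircle.coe_add, add_eq_left]
  exact (AddCircle.coe_eq_zero_iff (1 : ℝ)).2 ⟨n j, by simp⟩

theorem exists_eq_add_intVec {v w : Fin k → ℝ} (h : torusMk v = torusMk w) :
    ∃ n : Fin k → ℤ, v = w + intVec n := by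
  have key : ∀ j, ∃ n : ℤ, v j = w j + n := fun j => by
    have hj : ((v j - w j : ℝ) : UnitAddCircle) = 0 := by
      rw [AddCircle.coe_sub, sub_eq_zero]
      exact congrFun h j
    obtain ⟨n, hn⟩ := (AddCircle.coe_eq_zero_iff (1 : ℝ)).1 hj
    refine ⟨n, ?_⟩
    simp only [zsmul_eq_mul, mul_one] at hn
    linarith
  choose n hn using key
  exact ⟨n, funext hn⟩

theorem exists_lift_homotopy {A : Type*} [TopologicalSpace A]
    (H : C(I × A, Fin k → UnitAddCircle)) (f : C(A, Fin k → ℝ))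
    (h0 : ∀ a, H (0, a) = torusMk (f a)) :
    ∃ L : C(I × A, Fin k → ℝ), (∀ z, torusMk (L z) = H z) ∧ ∀ a, L (0, a) = f a := by
  have key : ∀ j, ∃ L : C(I × A, ℝ), (∀ z, (L z : UnitAddCircle) = H z j) ∧
      ∀ a, L (0, a) = f a j := fun j => by
    let Hj : C(I × A, UnitAddCircle) := ⟨fun z => H z j, by fun_prop⟩
    let fj : C(A, ℝ) := ⟨fun a => f a j, by fun_prop⟩
    have hj : ∀ a, Hj (0, a) = (fj a : UnitAddCircle) := fun a => congrFun (h0 a) j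
    have cov := AddCircle.isCoveringMap_coe (1 : ℝ)
    exact ⟨cov.liftHomotopy Hj fj hj, congrFun (cov.liftHomotopy_lifts Hj fj hj),
      cov.liftHomotopy_zero Hj fj hj⟩
  choose L hL hL0 using key
  exact ⟨⟨fun z j => L j z, by fun_prop⟩, fun z => funext fun j => hL j z,
    fun a => funext fun j => hL0 j a⟩

theorem lift_unique {A : Type*} [TopologicalSpace A] [PreconnectedSpace A] {u v : A → Fin k → ℝ}
    (hu : Continuous u) (hv : Continuous v) (h : ∀ a, torusMk (u a) = torusMk (v a)) (a₀ : A)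
    (h0 : u a₀ = v a₀) : u = v := by
  have key : ∀ j, (fun a => u a j) = fun a => v a j := fun j =>
    (AddCircle.isCoveringMap_coe (1 : ℝ)).eq_of_comp_eq ((continuous_apply j).comp hu)
      ((continuous_apply j).comp hv) (funext fun a => congrFun (h a) j) a₀ (congrFun h0 j)
  exact funext fun a => funext fun j => congrFun (key j) a

theorem exists_lift_eq_add_intVec {A : Type*} [TopologicalSpace A] [ConnectedSpace A]
    {u v : A → Fin k → ℝ} (hu : Continuous u) (hv : Continuous v)
    (h : ∀ a, torusMk (u a) = torusMk (v a)) :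
    ∃ n : Fin k → ℤ, ∀ a, u a = v a + intVec n := by
  obtain ⟨a₀⟩ := (inferInstance : Nonempty A)
  obtain ⟨n, hn⟩ := exists_eq_add_intVec (h a₀)
  refine ⟨n, congrFun (lift_unique hu (hv.add continuous_const) (fun a => ?_) a₀ hn)⟩
  rw [torusMk_add_intVec, h]

theorem exists_lift_of_contractible {A : Type*} [TopologicalSpace A] [ContractibleSpace A]
    (u : C(A, Fin k → UnitAddCircle)) : ∃ w : C(A, Fin k → ℝ), ∀ a, torusMk (w a) = u a := by
  obtain ⟨p, ⟨C⟩⟩ := id_nullhomotopic A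
  obtain ⟨v, hv⟩ := torusMk_surjective (u p)
  obtain ⟨L, hL, -⟩ := exists_lift_homotopy (u.comp C.symm.toContinuousMap)
    (ContinuousMap.const A v) fun a => by simp [hv]
  refine ⟨⟨fun a => L (1, a), by fun_prop⟩, fun a => ?_⟩
  simp [hL]

variable {X : Type} [TopologicalSpace X]

/-- The pullback to `X` of the covering `ℝ^k → (ℝ/ℤ)^k`. -/
abbrev Cover (f : C(X, Fin k → UnitAddCircle)) : Type :=
  {p : X × (Fin k → ℝ) // f p.1 = torusMk p.2}

variable {f : C(X, Fin k → UnitAddCircle)}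

/-- The action of `ℤ^k` on the covering by translations. -/
def translate (n : Fin k → ℤ) (y : Cover f) : Cover f :=
  ⟨(y.1.1, y.1.2 + intVec n), by rw [torusMk_add_intVec]; exact y.2⟩

theorem continuous_translate (n : Fin k → ℤ) : Continuous (translate n : Cover f → _) := by
  unfold translate
  fun_prop

theorem translate_add (m n : Fin k → ℤ) (y : Cover f) :
    translate (m + n) y = translate m (translate n y) := by
  apply Subtype.ext
  simp [translate, intVec_add, add_comm, add_left_comm]

theorem translate_zero (y : Cover f) : translate 0 y = y := by
  apply Subtype.ext
  apply Prod.ext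
  · rfl
  · funext j
    simp [translate, intVec]

theorem translate_injective (y : Cover f) : Function.Injective fun n => translate n y :=
  fun m n h => by
    have := congrArg (fun z : Cover f => z.1.2) h
    exact intVec_injective (add_left_cancel this)

theorem cover_ext {y z : Cover f} (h1 : y.1.1 = z.1.1) (h2 : y.1.2 = z.1.2) : y = z :=
  Subtype.ext (Prod.ext h1 h2)

theorem exists_path_to_translate [PathConnectedSpace X] (y z : Cover f) :
    ∃ (c : C(I, Cover f)) (n : Fin k → ℤ), c 0 = y ∧ c 1 = translate n z := by
  obtain ⟨γ⟩ := PathConnectedSpace.joined y.1.1 z.1.1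
  obtain ⟨L, hL, hL0⟩ := exists_lift_homotopy (A := Unit)
    ((f.comp γ.toContinuousMap).comp ContinuousMap.fst) (ContinuousMap.const _ y.1.2)
    fun _ => by simpa using y.2
  let c : C(I, Cover f) := ⟨fun s => ⟨(γ s, L (s, ())), (hL (s, ())).symm⟩, by fun_prop⟩
  have h1 : torusMk (c 1).1.2 = torusMk z.1.2 := by
    rw [← (c 1).2, ← z.2]
    simp [c]
  obtain ⟨n, hn⟩ := exists_eq_add_intVec h1
  exact ⟨c, n, cover_ext (by simp [c]) (hL0 ()), cover_ext (by simp [c, translate]) hn⟩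

theorem contractibleSpace_cover [PathConnectedSpace X] (h : C(Fin k → UnitAddCircle, X))
    (H : ContinuousMap.Homotopy (ContinuousMap.id X) (h.comp f))
    (K : ContinuousMap.Homotopy (ContinuousMap.id (Fin k → UnitAddCircle)) (f.comp h)) :
    ContractibleSpace (Cover f) := by
  let mk : C(Fin k → ℝ, Fin k → UnitAddCircle) := ⟨torusMk, continuous_torusMk⟩
  obtain ⟨L, hL, hL0⟩ := exists_lift_homotopy (A := Cover f)
    ⟨fun z => f (H (z.1, z.2.1.1)), by fun_prop⟩ ⟨fun y => y.1.2, by fun_prop⟩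
    fun y => by simpa using y.2
  obtain ⟨M, hM, hM0⟩ := exists_lift_homotopy (A := Fin k → ℝ)
    ⟨fun z => K (z.1, mk z.2), by fun_prop⟩ (ContinuousMap.id _) fun y => by simp [mk]
  simp only [ContinuousMap.coe_mk, ContinuousMap.id_apply] at hL hL0 hM hM0
  have hLM : ∀ y : Cover f, torusMk (L (1, y)) = torusMk (M (1, y.1.2)) := fun y => by
    rw [hL, hM]
    simp [mk, y.2]
  have hLn : ∀ n y, L (1, translate n y) = L (1, y) + intVec n := fun n y => by
    refine congrFun (lift_unique (A := I) (u := fun s => L (s, translate n y))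
      (v := fun s => L (s, y) + intVec n) (by fun_prop) (by fun_prop) (fun s => ?_) 0 ?_) 1
    · rw [torusMk_add_intVec, hL, hL]
      rfl
    · rw [hL0, hL0]
      rfl
  have hMn : ∀ n v, M (1, v + intVec n) = M (1, v) + intVec n := fun n v => by
    refine congrFun (lift_unique (A := I) (u := fun s => M (s, v + intVec n))
      (v := fun s => M (s, v) + intVec n) (by fun_prop) (by fun_prop) (fun s => ?_) 0 ?_) 1
    · rw [torusMk_add_intVec, hM, hM]
      simp [mk, torusMk_add_intVec]
    · rw [hM0, hM0]
  obtain ⟨v₀, hv₀⟩ := torusMk_surjective (f (h 0))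
  let y₀ : Cover f := ⟨(h 0, v₀), hv₀.symm⟩
  obtain ⟨N, hN⟩ := exists_eq_add_intVec (hLM y₀)
  have hconst : ∀ y : Cover f, L (1, y) = M (1, y.1.2) + intVec N := fun y => by
    obtain ⟨c, n, hc0, hc1⟩ := exists_path_to_translate y₀ y
    obtain ⟨m, hm⟩ := exists_lift_eq_add_intVec (A := I) (u := fun s => L (1, c s))
      (v := fun s => M (1, (c s).1.2)) (by fun_prop) (by fun_prop) fun s => hLM (c s)
    have h0 := hm 0
    have h1 := hm 1
    simp only [hc0, hc1] at h0 h1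
    have hmN : intVec m = intVec N := add_left_cancel (h0.symm.trans hN)
    rw [hLn] at h1
    have : M (1, (translate n y).1.2) = M (1, y.1.2) + intVec n := hMn n y.1.2
    rw [this, hmN, add_right_comm] at h1
    exact add_right_cancel h1
  have hfh : ∀ v, f (h (mk v)) = torusMk (M (1, v) + intVec N) := fun v => by
    rw [torusMk_add_intVec, hM]
    simp
  let E : C((Fin k → ℝ), Cover f) := ⟨fun v => ⟨(h (mk v), M (1, v) + intVec N), hfh v⟩, by
    fun_prop⟩
  let pr : C(Cover f, Fin k → ℝ) := ⟨fun y => y.1.2, by fun_prop⟩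
  have C₁ : ContinuousMap.Homotopy (ContinuousMap.id (Cover f)) (E.comp pr) :=
    { toFun := fun z => ⟨(H (z.1, z.2.1.1), L z), (hL z).symm⟩
      continuous_toFun := by fun_prop
      map_zero_left := fun y => cover_ext (by simp) (by simp [hL0])
      map_one_left := fun y => cover_ext (by simp [E, pr, mk, y.2])
        (by simp [hconst, E, pr]) }
  have C₂ : ContinuousMap.Homotopy (E.comp pr) (ContinuousMap.const _ (E 0)) :=
    { toFun := fun z => E ((1 - (z.1 : ℝ)) • pr z.2)
      continuous_toFun := by fun_prop
      map_zero_left := fun y => by simp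
      map_one_left := fun y => by simp }
  exact (contractible_iff_id_nullhomotopic _).2 ⟨E 0, ⟨C₁.trans C₂⟩⟩

theorem pathConnectedSpace_of_homotopy {T : Type*} [TopologicalSpace T] [PathConnectedSpace T]
    (f : C(X, T)) (h : C(T, X)) (H : ContinuousMap.Homotopy (ContinuousMap.id X) (h.comp f)) :
    PathConnectedSpace X := by
  have key : ∀ x, Joined x (h (f x)) := fun x => ⟨(H.evalAt x).cast (by simp) (by simp)⟩
  refine ⟨(inferInstance : Nonempty T).map h, fun x y => ?_⟩
  obtain ⟨γ⟩ := PathConnectedSpace.joined (f x) (f y)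
  exact ((key x).trans ⟨γ.map h.continuous⟩).trans (key y).symm

theorem exists_eq_translate [ConnectedSpace (Cover f)] {δ : Cover f → Cover f}
    (hδ : Continuous δ) (h : ∀ y, (δ y).1.1 = y.1.1) :
    ∃ n : Fin k → ℤ, ∀ y, δ y = translate n y := by
  obtain ⟨n, hn⟩ := exists_lift_eq_add_intVec (A := Cover f) (u := fun y => (δ y).1.2)
    (v := fun y => y.1.2) (by fun_prop) (by fun_prop) fun y => by rw [← (δ y).2, ← y.2, h]
  exact ⟨n, fun y => cover_ext (h y) (hn y)⟩

theorem exists_lift_map [ContractibleSpace (Cover f)] {a : X → X} (ha : Continuous a) :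
    ∃ δ : Cover f → Cover f, Continuous δ ∧ ∀ y, (δ y).1.1 = a y.1.1 := by
  obtain ⟨w, hw⟩ := exists_lift_of_contractible (A := Cover f)
    ⟨fun y => f (a y.1.1), by fun_prop⟩
  exact ⟨fun y => ⟨(a y.1.1, w y), (hw y).symm⟩, by fun_prop, fun _ => rfl⟩

variable (f) (G : Type) [Group G] [MulAction G X]

/-- The group of pairs of an element of `G` and a lift of its action to the covering. -/
def liftGroup : Subgroup (G × Equiv.Perm (Cover f)) where
  carrier := {p | Continuous p.2 ∧ Continuous p.2.symm ∧ ∀ y, (p.2 y).1.1 = p.1 • y.1.1}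
  one_mem' := ⟨continuous_id, continuous_id, fun y => (one_smul G y.1.1).symm⟩
  mul_mem' := fun {p q} hp hq => ⟨hp.1.comp hq.1, hq.2.1.comp hp.2.1, fun y => by
    change (p.2 (q.2 y)).1.1 = (p.1 * q.1) • y.1.1
    rw [hp.2.2, hq.2.2, mul_smul]⟩
  inv_mem' := fun {p} hp => ⟨hp.2.1, hp.1, fun y => by
    change (p.2.symm y).1.1 = p.1⁻¹ • y.1.1
    rw [eq_inv_smul_iff, ← hp.2.2, Equiv.apply_symm_apply]⟩

/-- Translations as elements of the group of lifts. -/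
def translation (n : Fin k → ℤ) : liftGroup f G :=
  ⟨(1, ⟨translate n, translate (-n),
    fun y => by rw [← translate_add, neg_add_cancel, translate_zero],
    fun y => by rw [← translate_add, add_neg_cancel, translate_zero]⟩),
    continuous_translate n, continuous_translate (-n), fun y => (one_smul G y.1.1).symm⟩

/-- The projection of the group of lifts to `G`. -/
def liftGroupProj : liftGroup f G →* G := (MonoidHom.fst _ _).comp (liftGroup f G).subtype

variable {f G}

theorem liftGroup_ext {p q : liftGroup f G} (h1 : p.1.1 = q.1.1) (h2 : ∀ y, p.1.2 y = q.1.2 y) :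
    p = q :=
  Subtype.ext (Prod.ext h1 (Equiv.ext h2))

theorem translation_add (m n : Fin k → ℤ) :
    translation f G (m + n) = translation f G m * translation f G n :=
  liftGroup_ext (one_mul 1).symm (translate_add m n)

theorem translation_injective [Nonempty (Cover f)] :
    Function.Injective (translation f G) := fun m n h => by
  obtain ⟨y⟩ := (inferInstance : Nonempty (Cover f))
  exact translate_injective y (congrArg (fun p : liftGroup f G => p.1.2 y) h)

theorem liftGroupProj_eq_one_iff [ConnectedSpace (Cover f)] (p : liftGroup f G) :
    liftGroupProj f G p = 1 ↔ ∃ n, translation f G n = p := by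
  constructor
  · intro h
    have h1 : p.1.1 = 1 := h
    obtain ⟨n, hn⟩ := exists_eq_translate p.2.1 fun y => by
      rw [p.2.2.2, h1, one_smul]
    exact ⟨n, liftGroup_ext h1.symm fun y => (hn y).symm⟩
  · rintro ⟨n, rfl⟩
    rfl

theorem liftGroupProj_surjective [ContinuousConstSMul G X] [ContractibleSpace (Cover f)] :
    Function.Surjective (liftGroupProj f G) := fun g => by
  obtain ⟨δ, hδ, hδg⟩ := exists_lift_map (f := f) (continuous_const_smul g)
  obtain ⟨ε, hε, hεg⟩ := exists_lift_map (f := f) (continuous_const_smul g⁻¹)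
  obtain ⟨n, hn⟩ := exists_eq_translate (hε.comp hδ) fun y => by
    rw [Function.comp_apply, hεg, hδg, inv_smul_smul]
  obtain ⟨m, hm⟩ := exists_eq_translate (hδ.comp hε) fun y => by
    rw [Function.comp_apply, hδg, hεg, smul_inv_smul]
  have hleft : ∀ y, translate (-n) (ε (δ y)) = y := fun y => by
    rw [← Function.comp_apply (f := ε), hn, ← translate_add, neg_add_cancel, translate_zero]
  have hright : Function.Surjective δ := fun y => ⟨ε (translate (-m) y), by
    rw [← Function.comp_apply (f := δ), hm, ← translate_add, add_neg_cancel, translate_zero]⟩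
  let e : Equiv.Perm (Cover f) := ⟨δ, fun y => translate (-n) (ε y), hleft, fun y => by
    obtain ⟨x, rfl⟩ := hright y
    exact congrArg δ (hleft x)⟩
  exact ⟨⟨(g, e), hδ, (continuous_translate (-n)).comp hε, hδg⟩, rfl⟩

theorem liftGroup_eq_one_of_mul_self [ContractibleSpace (Cover f)] (hX : IsCompactSeparated X)
    [ContinuousConstSMul G X] (hfree : ∀ (g : G) (x : X), g • x = x → g = 1)
    (p : liftGroup f G) (hp : p * p = 1) : p = 1 := by
  have hpp : ∀ y, p.1.2 (p.1.2 y) = y := fun y =>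
    congrArg (fun q : liftGroup f G => q.1.2 y) hp
  have hg : p.1.1 * p.1.1 = 1 := congrArg (fun q : liftGroup f G => q.1.1) hp
  by_cases h1 : p.1.1 = 1
  · obtain ⟨n, rfl⟩ := (liftGroupProj_eq_one_iff p).1 h1
    have h0 : translation f G 0 = 1 := liftGroup_ext rfl translate_zero
    rw [← translation_add, ← h0] at hp
    have hn : n + n = 0 := translation_injective hp
    have : n = 0 := funext fun j => by
      have := congrFun hn j
      simp only [Pi.add_apply, Pi.zero_apply] at this ⊢
      omega
    rw [this, h0]
  · exfalso
    obtain ⟨s, F, hF, hodd, hbig⟩ := hX.exists_odd_map (continuous_const_smul p.1.1)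
      (fun x => by rw [← mul_smul, hg, one_smul]) fun x hx => h1 (hfree _ x hx)
    obtain ⟨c, ⟨C⟩⟩ := id_nullhomotopic (Cover f)
    exact false_of_odd_map_of_contraction C.toContinuousMap c (fun y => by simp)
      (fun y => by simp) p.2.1 hpp (F := fun y => F y.1.1) (by fun_prop)
      (fun y => by rw [p.2.2.2, hodd]) fun y => hbig y.1.1

end TorusCover

open TorusCover in
/-- An elementary abelian `2`-group acting freely on a compact space homotopy equivalent to
the `k`-torus has order at most `2 ^ k`. -/
theorem card_le_two_pow_of_free_action {k : ℕ} {X G : Type} [TopologicalSpace X]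
    (hX : IsCompactSeparated X) (e : ContinuousMap.HomotopyEquiv X (Fin k → UnitAddCircle))
    [Group G] [Finite G] [MulAction G X] [ContinuousConstSMul G X]
    (hfree : ∀ (g : G) (x : X), g • x = x → g = 1) (hG : ∀ g : G, g * g = 1) :
    Nat.card G ≤ 2 ^ k := by
  obtain ⟨H⟩ := e.left_inv
  obtain ⟨K⟩ := e.right_inv
  have : PathConnectedSpace X := pathConnectedSpace_of_homotopy e.toFun e.invFun H.symm
  have : ContractibleSpace (Cover e.toFun) := contractibleSpace_cover e.invFun H.symm K.symm
  exact card_le_two_pow_of_extension k (translation e.toFun G) (liftGroupProj e.toFun G)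
    translation_add translation_injective liftGroupProj_surjective liftGroupProj_eq_one_iff hG
    (liftGroup_eq_one_of_mul_self hX hfree) (by simp)

/-- The unit sphere in `ℝ²` is homeomorphic to `ℝ/ℤ`. -/
noncomputable def sphereHomeoUnitAddCircle : Sph 1 ≃ₜ UnitAddCircle :=
  (Homeomorph.subtype Complex.orthonormalBasisOneI.repr.symm.toHomeomorph fun v => by
    rw [mem_sphere_zero_iff_norm, ← LinearIsometryEquiv.norm_map
      Complex.orthonormalBasisOneI.repr.symm v]
    exact mem_sphere_zero_iff_norm.symm : Sph 1 ≃ₜ Circle).trans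
    (AddCircle.homeomorphCircle one_ne_zero).symm

/-- **Yalcin's theorem.** If a finite group `G` acts freely and continuously on a finite CW
complex `X` homotopy equivalent to the `k`-torus `(S^1)^k`, then `r₂(G) ≤ k`: whenever
`(ℤ/2)^r` embeds into `G` we have `r ≤ k` (equivalently, `G` contains no subgroup
isomorphic to `(ℤ/2)^{k+1}`). -/
theorem yalcin_two_rank_le_of_free_action_on_torus
    (G : Type) [Group G] [Finite G] (k : ℕ)
    (X : Type) [TopologicalSpace X] (hX : IsFiniteCW X)
    (e : Nonempty (ContinuousMap.HomotopyEquiv X (Fin k → Sph 1)))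
    (φ : G →* (X ≃ₜ X))
    (hfree : ∀ (g : G) (x : X), φ g x = x → g = 1) :
    ∀ r : ℕ, (∃ f : (Fin r → Multiplicative (ZMod 2)) →* G, Function.Injective f) → r ≤ k := by
  rintro r ⟨i, hi⟩
  obtain ⟨n, hn⟩ := hX
  obtain ⟨e⟩ := e
  let _ : MulAction (Fin r → Multiplicative (ZMod 2)) X :=
    { smul := fun g x => φ (i g) x
      one_smul := fun x => by
        change φ (i 1) x = x
        rw [map_one, map_one]
        rfl
      mul_smul := fun g h x => by
        change φ (i (g * h)) x = φ (i g) (φ (i h) x)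
        rw [map_mul, map_mul]
        rfl }
  have : ContinuousConstSMul (Fin r → Multiplicative (ZMod 2)) X :=
    ⟨fun g => (φ (i g)).continuous⟩
  have hcard := card_le_two_pow_of_free_action (G := Fin r → Multiplicative (ZMod 2))
    hn.isCompactSeparated
    (e.trans (Homeomorph.piCongrRight fun _ => sphereHomeoUnitAddCircle).toHomotopyEquiv)
    (fun g x h => hi ((hfree _ x h).trans (map_one i).symm))
    fun g => funext fun j => by
      change g j * g j = 1
      exact (by decide : ∀ a : Multiplicative (ZMod 2), a * a = 1) (g j)
  have hr : Nat.card (Fin r → Multiplicative (ZMod 2)) = 2 ^ r := by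
    simp [Nat.card_eq_fintype_card, ZMod.card]
  rw [hr] at hcard
  exact (Nat.pow_le_pow_iff_right one_lt_two).1 hcard
end

section
/- There exists a continuous action of the elementary abelian 2-group G = (ℤ/2)^{1249} on the space X = (ℝP^{2^{1298}−1})^{50}, the product of 50 copies of real projective space of dimension 2^{1298}−1, such that every isotropy subgroup has rank at most 50; that is, for every point x ∈ X, the stabilizer subgroup G_x contains no subgroup isomorphic to (ℤ/2)^{51}. -/
open Metric

open scoped LinearAlgebra.Projectivization

/-- Real projective `n`-space `ℝP^n`, the projectivization of `ℝ^{n+1}`. -/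
abbrev RP (n : ℕ) : Type := ℙ ℝ (EuclideanSpace ℝ (Fin (n + 1)))

/-- `ℝP^n` carries the quotient topology coming from `ℝ^{n+1} \ {0}`. -/
noncomputable instance (n : ℕ) : TopologicalSpace (RP n) :=
  (inferInstance :
    TopologicalSpace (Quotient (projectivizationSetoid ℝ (EuclideanSpace ℝ (Fin (n + 1))))))

/-- If `m * n < k * (m choose 2)`, there are `k` bilinear forms on `𝔽₂ⁿ` whose commutator forms
have no common isotropic subspace of dimension `m`. -/
theorem exists_bilin_no_common_isotropic {k m n : ℕ}
    (h : m * n < k * ∑ j ∈ Finset.range m, j) :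
    ∃ B : Fin k → ((Fin n → ZMod 2) →ₗ[ZMod 2] (Fin n → ZMod 2) →ₗ[ZMod 2] ZMod 2),
      ∀ f : (Fin m → ZMod 2) →ₗ[ZMod 2] (Fin n → ZMod 2), Function.Injective f →
        ∃ i a b, B i (f a) (f b) ≠ B i (f b) (f a) := by
  by_contra! H
  choose f hf hB using H
  let F := (Fin m → ZMod 2) →ₗ[ZMod 2] (Fin n → ZMod 2)
  have hg : ∀ f : F, ∃ g : (Fin n → ZMod 2) →ₗ[ZMod 2] (Fin m → ZMod 2),
      Function.Injective f → ∀ a, g (f a) = a := by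
    intro f
    by_cases hf : Function.Injective f
    · obtain ⟨g, hg⟩ := f.exists_leftInverse_of_injective (LinearMap.ker_eq_bot.2 hf)
      exact ⟨g, fun _ a => LinearMap.congr_fun hg a⟩
    · exact ⟨0, fun h => absurd h hf⟩
  choose g hg using hg
  let Ω := Fin k → ((Fin n → ZMod 2) →ₗ[ZMod 2] (Fin n → ZMod 2) →ₗ[ZMod 2] ZMod 2)
  let T := Fin k → (Σ j : Fin m, Fin j) → ZMod 2
  let c : T → Fin k → Matrix (Fin m) (Fin m) (ZMod 2) := fun C i =>
    Matrix.of fun s t => if hst : (s : ℕ) < t then C i ⟨t, ⟨s, hst⟩⟩ else 0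
  let D : F → T → Ω := fun f C i =>
    (Matrix.toLinearMap₂' (ZMod 2) (c C i)).compl₁₂ (g f) (g f)
  have hD : ∀ f : F, Function.Injective f → ∀ C i s t,
      D f C i (f (Pi.single s 1)) (f (Pi.single t 1)) = c C i s t := by
    intro f hf C i s t
    simp [D, LinearMap.compl₁₂_apply, hg f hf, Matrix.toLinearMap₂'_apply']
  let Φ : Ω × T → F × Ω := fun p => (f p.1, p.1 + D (f p.1) p.2)
  have hΦ : Function.Injective Φ := by
    rintro ⟨B, C⟩ ⟨B', C'⟩ hp
    obtain ⟨h1, h2⟩ := Prod.ext_iff.1 hp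
    simp only [Φ] at h1 h2
    rw [← h1] at h2
    have hBf' := hB B'
    rw [← h1] at hBf'
    have hC : C = C' := by
      funext i ⟨t, s⟩
      have ev : ∀ a b, B i a b + D (f B) C i a b = B' i a b + D (f B) C' i a b := fun a b =>
        LinearMap.congr_fun (LinearMap.congr_fun (congrFun h2 i) a) b
      let s' : Fin m := ⟨s, s.2.trans t.2⟩
      have e1 := ev (f B (Pi.single s' 1)) (f B (Pi.single t 1))
      have e2 := ev (f B (Pi.single t 1)) (f B (Pi.single s' 1))
      rw [hD _ (hf B), hD _ (hf B)] at e1 e2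
      have c1 : ∀ C : T, c C i s' t = C i ⟨t, s⟩ := fun C => dif_pos s.2
      have c2 : ∀ C : T, c C i t s' = 0 := fun C => dif_neg (not_lt.2 s.2.le)
      rw [c1, c1] at e1
      rw [c2, c2] at e2
      have e3 := hB B i (Pi.single s' 1) (Pi.single t 1)
      have e4 := hBf' i (Pi.single s' 1) (Pi.single t 1)
      linear_combination e1 - e2 - e3 + e4
    subst hC
    exact Prod.ext (funext fun i => LinearMap.ext₂ fun a b => add_right_cancel
      (LinearMap.congr_fun (LinearMap.congr_fun (congrFun h2 i) a) b)) rfl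
  have : Finite F := DFunLike.finite _
  have : Finite ((Fin n → ZMod 2) →ₗ[ZMod 2] ZMod 2) := DFunLike.finite _
  have : Finite ((Fin n → ZMod 2) →ₗ[ZMod 2] (Fin n → ZMod 2) →ₗ[ZMod 2] ZMod 2) :=
    DFunLike.finite _
  have : Finite Ω := Pi.finite
  have hcard := Nat.card_le_card_of_injective Φ hΦ
  rw [Nat.card_prod, Nat.card_prod, mul_comm] at hcard
  have hle := Nat.le_of_mul_le_mul_right hcard Nat.card_pos
  have hT : Nat.card T = 2 ^ (k * ∑ j ∈ Finset.range m, j) := by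
    simp [T, Fin.sum_univ_eq_sum_range (fun j => j), ← pow_mul, mul_comm]
  have hF : Nat.card F = 2 ^ (m * n) := by
    rw [Nat.card_congr (LinearMap.toMatrix' (R := ZMod 2) (n := Fin m) (m := Fin n)).toEquiv]
    simp [Matrix, ← pow_mul]
  rw [hT, hF] at hle
  exact absurd hle (not_le.2 (Nat.pow_lt_pow_right one_lt_two h))

/-- The nontrivial real character of `ℤ/2`. -/
def zmodTwoSign (x : ZMod 2) : ℝ := if x = 0 then 1 else -1

theorem zmodTwoSign_add (x y : ZMod 2) :
    zmodTwoSign (x + y) = zmodTwoSign x * zmodTwoSign y := by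
  revert x y
  simp [Fin.forall_fin_two, zmodTwoSign, ZMod]

theorem zmodTwoSign_ne_zero (x : ZMod 2) : zmodTwoSign x ≠ 0 := by
  unfold zmodTwoSign
  split_ifs <;> norm_num

theorem zmodTwoSign_injective : Function.Injective zmodTwoSign := by
  intro x y
  revert x y
  simp [Fin.forall_fin_two, zmodTwoSign, ZMod]
  norm_num

theorem RP.continuous_map {N : ℕ}
    (L : EuclideanSpace ℝ (Fin (N + 1)) →ₗ[ℝ] EuclideanSpace ℝ (Fin (N + 1)))
    (hL : Function.Injective L) :
    Continuous (Projectivization.map L hL : RP N → RP N) := by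
  refine continuous_quot_lift _ (continuous_quot_mk.comp ?_)
  exact (L.continuous_of_finiteDimensional.comp continuous_subtype_val).subtype_mk _

/-- The twisted translations `T g` with `T g (T h v) = ± T (g + h) v`, the sign being given by
the bilinear form `B`. -/
noncomputable def twistedTranslation {N l : ℕ} {V : Type*} [AddCommGroup V] [Module (ZMod 2) V]
    (e : Fin (N + 1) ≃ V × Fin l) (B : V →ₗ[ZMod 2] V →ₗ[ZMod 2] ZMod 2) (g : V) :
    EuclideanSpace ℝ (Fin (N + 1)) →ₗ[ℝ] EuclideanSpace ℝ (Fin (N + 1)) where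
  toFun v := WithLp.toLp 2 fun x => zmodTwoSign (B g (e x).1) * v (e.symm ((e x).1 + g, (e x).2))
  map_add' v w := by ext x; simp [mul_add]
  map_smul' r v := by ext x; simp; ring

section

variable {N l : ℕ} {V : Type*} [AddCommGroup V] [Module (ZMod 2) V]
  (e : Fin (N + 1) ≃ V × Fin l) (B : V →ₗ[ZMod 2] V →ₗ[ZMod 2] ZMod 2)

theorem twistedTranslation_apply (g : V) (v : EuclideanSpace ℝ (Fin (N + 1))) (x : Fin (N + 1)) :
    twistedTranslation e B g v x =
      zmodTwoSign (B g (e x).1) * v (e.symm ((e x).1 + g, (e x).2)) := rfl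

theorem twistedTranslation_comp (g h : V) (v : EuclideanSpace ℝ (Fin (N + 1))) :
    twistedTranslation e B g (twistedTranslation e B h v) =
      zmodTwoSign (B h g) • twistedTranslation e B (g + h) v := by
  ext x
  simp only [twistedTranslation_apply, PiLp.smul_apply, smul_eq_mul, Equiv.apply_symm_apply,
    map_add, LinearMap.add_apply, zmodTwoSign_add, add_assoc]
  ring

theorem twistedTranslation_zero (v : EuclideanSpace ℝ (Fin (N + 1))) :
    twistedTranslation e B 0 v = v := by
  ext x
  simp [twistedTranslation_apply, zmodTwoSign]

theorem twistedTranslation_injective (g : V) : Function.Injective (twistedTranslation e B g) := by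
  refine (injective_iff_map_eq_zero _).2 fun v hv => ?_
  have h := twistedTranslation_comp e B (-g) g v
  rw [hv, map_zero, neg_add_cancel, twistedTranslation_zero] at h
  exact (smul_eq_zero.1 h.symm).resolve_left (zmodTwoSign_ne_zero _)

theorem map_twistedTranslation_add (g h : V) (p : RP N) :
    Projectivization.map (twistedTranslation e B (g + h)) (twistedTranslation_injective e B _) p =
      Projectivization.map (twistedTranslation e B g) (twistedTranslation_injective e B g)
        (Projectivization.map (twistedTranslation e B h)
          (twistedTranslation_injective e B h) p) := by
  induction p using Projectivization.ind with
  | h v hv =>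
    simp only [Projectivization.map_mk]
    refine ((Projectivization.mk_eq_mk_iff' ..).2 ⟨zmodTwoSign (B h g), ?_⟩).symm
    exact (twistedTranslation_comp e B g h v).symm

theorem map_twistedTranslation_zero (p : RP N) :
    Projectivization.map (twistedTranslation e B 0) (twistedTranslation_injective e B _) p = p := by
  induction p using Projectivization.ind with
  | h v hv => simp only [Projectivization.map_mk, twistedTranslation_zero]

/-- If `a` and `b` fix a common line, then `B` is symmetric on the pair `a`, `b`. -/
theorem bilin_symm_of_fixed {a b : V} {p : RP N}
    (ha : Projectivization.map (twistedTranslation e B a) (twistedTranslation_injective e B a) p = p)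
    (hb : Projectivization.map (twistedTranslation e B b)
      (twistedTranslation_injective e B b) p = p) :
    B a b = B b a := by
  induction p using Projectivization.ind with
  | h v hv =>
    rw [Projectivization.map_mk, Projectivization.mk_eq_mk_iff'] at ha hb
    obtain ⟨r, hr⟩ := ha
    obtain ⟨s, hs⟩ := hb
    have h1 := twistedTranslation_comp e B a b v
    have h2 := twistedTranslation_comp e B b a v
    rw [← hs, map_smul, ← hr, smul_smul] at h1
    rw [← hr, map_smul, ← hs, smul_smul, mul_comm, h1, add_comm b a] at h2
    have hne : twistedTranslation e B (a + b) v ≠ 0 := fun h =>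
      hv (twistedTranslation_injective e B (a + b) (h.trans (map_zero _).symm))
    exact (zmodTwoSign_injective (smul_left_injective ℝ hne h2)).symm

/-- The action of `V` on `ℝPᴺ` by twisted translations. -/
noncomputable def projectiveAction : Multiplicative V →* (RP N ≃ₜ RP N) where
  toFun g :=
    { toFun := Projectivization.map (twistedTranslation e B g.toAdd)
        (twistedTranslation_injective e B _)
      invFun := Projectivization.map (twistedTranslation e B (-g.toAdd))
        (twistedTranslation_injective e B _)
      left_inv p := by
        simp only [← map_twistedTranslation_add, neg_add_cancel, map_twistedTranslation_zero]
      right_inv p := by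
        simp only [← map_twistedTranslation_add, add_neg_cancel, map_twistedTranslation_zero]
      continuous_toFun := RP.continuous_map _ _
      continuous_invFun := RP.continuous_map _ _ }
  map_one' := Homeomorph.ext fun p => map_twistedTranslation_zero e B p
  map_mul' g h := Homeomorph.ext fun p => map_twistedTranslation_add e B g.toAdd h.toAdd p

end

theorem exists_action_with_small_isotropy {k m n l N : ℕ}
    (h : m * n < k * ∑ j ∈ Finset.range m, j) (hN : N + 1 = 2 ^ n * l) :
    ∃ φ : (Fin n → Multiplicative (ZMod 2)) →* ((Fin k → RP N) ≃ₜ (Fin k → RP N)),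
      ∀ x : Fin k → RP N,
        ¬ ∃ f : (Fin m → Multiplicative (ZMod 2)) →* (Fin n → Multiplicative (ZMod 2)),
          Function.Injective f ∧ ∀ v, φ (f v) x = x := by
  obtain ⟨B, hB⟩ := exists_bilin_no_common_isotropic h
  have e : Fin (N + 1) ≃ (Fin n → ZMod 2) × Fin l :=
    Fintype.equivOfCardEq (by simp [hN])
  let t : (Fin n → Multiplicative (ZMod 2)) →* Multiplicative (Fin n → ZMod 2) :=
    { toFun := fun g => Multiplicative.ofAdd fun i => (g i).toAdd
      map_one' := rfl
      map_mul' := fun _ _ => rfl }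
  let φ : (Fin n → Multiplicative (ZMod 2)) →* ((Fin k → RP N) ≃ₜ (Fin k → RP N)) :=
    { toFun := fun g => Homeomorph.piCongrRight fun i => projectiveAction e (B i) (t g)
      map_one' := Homeomorph.ext fun x => funext fun i => by
        rw [map_one]
        exact congrArg (fun q : RP N ≃ₜ RP N => q (x i)) (map_one (projectiveAction e (B i)))
      map_mul' := fun g h => Homeomorph.ext fun x => funext fun i => by
        rw [map_mul]
        exact congrArg (fun q : RP N ≃ₜ RP N => q (x i))
          (map_mul (projectiveAction e (B i)) (t g) (t h)) }
  refine ⟨φ, ?_⟩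
  rintro x ⟨f, hf, hfix⟩
  let f₀ : (Fin m → ZMod 2) →+ (Fin n → ZMod 2) :=
    { toFun := fun v i => (f (fun j => Multiplicative.ofAdd (v j)) i).toAdd
      map_zero' := congrArg (fun q i => (q i).toAdd) (map_one f)
      map_add' := fun v w => congrArg (fun q i => (q i).toAdd)
        (map_mul f (fun j => Multiplicative.ofAdd (v j)) (fun j => Multiplicative.ofAdd (w j))) }
  have hf₀ : Function.Injective (f₀.toZModLinearMap 2) := fun v w hvw => hf hvw
  obtain ⟨i, a, b, hab⟩ := hB _ hf₀
  exact hab (bilin_symm_of_fixed e (B i) (p := x i)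
    (congrFun (hfix fun j => Multiplicative.ofAdd (a j)) i)
    (congrFun (hfix fun j => Multiplicative.ofAdd (b j)) i))

/-- **Adem–Yalcin (after Ol'shanskii).** There exists a continuous action of
`G = (ℤ/2)^{1249}` on `X = (ℝP^{2^{1298}-1})^{50}` such that every isotropy subgroup has
rank at most `50`: for every `x ∈ X`, no subgroup of the stabilizer of `x` is isomorphic
to `(ℤ/2)^{51}`. -/
theorem exists_action_on_product_of_projective_spaces_with_small_isotropy :
    ∃ φ : (Fin 1249 → Multiplicative (ZMod 2)) →*
        ((Fin 50 → RP (2 ^ 1298 - 1)) ≃ₜ (Fin 50 → RP (2 ^ 1298 - 1))),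
      ∀ x : Fin 50 → RP (2 ^ 1298 - 1),
        ¬ ∃ f : (Fin 51 → Multiplicative (ZMod 2)) →* (Fin 1249 → Multiplicative (ZMod 2)),
          Function.Injective f ∧ ∀ v, φ (f v) x = x := by
  exact exists_action_with_small_isotropy (l := 2 ^ 49) (by rw [Finset.sum_range_id]; norm_num)
    (by rw [Nat.sub_add_cancel Nat.one_le_two_pow, ← pow_add 2 1249 49])
end

section
/- The group SL₃(𝔽₂) (the special linear group of 3×3 matrices of determinant 1 over the field with two elements, of order 168) acts freely and smoothly on the manifold S⁵ × S⁷; that is, there is a free action of SL₃(𝔽₂) on S⁵ × S⁷ in which every group element acts by a diffeomorphism. -/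
open Metric

open scoped Manifold

section KleinRepresentation

open Matrix

/-- The ring `ℤ[(-1 + √-7) / 2]`. -/
abbrev KleinInt : Type := QuadraticAlgebra ℤ (-2) (-1)

namespace KleinInt

/-- The exponent `k` for which the `k`-th power of the Singer cycle of `klein` carries the first
basis vector to the vector with the given coordinates. -/
def singerIndex : Fin 2 → Fin 2 → Fin 2 → Fin 7
  | 1, 0, 0 => 0
  | 0, 1, 0 => 1
  | 0, 0, 1 => 2
  | 1, 0, 1 => 3
  | 1, 1, 1 => 4
  | 1, 1, 0 => 5
  | 0, 1, 1 => 6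
  | 0, 0, 0 => 0

/-- A generator of a Singer cycle, acting transitively on the nonzero vectors. -/
def singer : Matrix (Fin 3) (Fin 3) (ZMod 2) := !![0, 0, 1; 1, 0, 0; 0, 1, 1]

/-- The inverses of the powers of the Singer cycle. -/
def singerInv : Fin 7 → Matrix (Fin 3) (Fin 3) (ZMod 2) := ![
  !![1, 0, 0; 0, 1, 0; 0, 0, 1],
  !![0, 1, 0; 1, 0, 1; 1, 0, 0],
  !![1, 0, 1; 1, 1, 0; 0, 1, 0],
  !![1, 1, 0; 1, 1, 1; 1, 0, 1],
  !![1, 1, 1; 0, 1, 1; 1, 1, 0],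
  !![0, 1, 1; 0, 0, 1; 1, 1, 1],
  !![0, 0, 1; 1, 0, 0; 0, 1, 1]]

/-- Twice the unitary matrices representing the powers of the Singer cycle. -/
def singerRep : Fin 7 → Matrix (Fin 3) (Fin 3) KleinInt := ![
  !![⟨2, 0⟩, 0, 0; 0, ⟨2, 0⟩, 0; 0, 0, ⟨2, 0⟩],
  !![⟨0, 1⟩, 1, 1; ⟨0, 1⟩, -1, -1; 0, ⟨-1, -1⟩, ⟨1, 1⟩],
  !![-1, -1, ⟨0, 1⟩; ⟨-1, -1⟩, ⟨1, 1⟩, 0; 1, 1, ⟨0, 1⟩],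
  !![⟨0, -1⟩, 1, -1; 0, ⟨-1, -1⟩, ⟨-1, -1⟩; ⟨0, 1⟩, 1, -1],
  !![⟨1, 1⟩, 0, ⟨-1, -1⟩; 1, ⟨0, 1⟩, 1; -1, ⟨0, 1⟩, -1],
  !![-1, ⟨0, 1⟩, 1; -1, ⟨0, -1⟩, 1; ⟨-1, -1⟩, 0, ⟨-1, -1⟩],
  !![⟨-1, -1⟩, ⟨-1, -1⟩, 0; 1, -1, ⟨0, 1⟩; 1, -1, ⟨0, -1⟩]]

/-- The permutations underlying the signed permutation matrices that represent the invertible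
`2 × 2` matrices over `𝔽₂`. -/
def permIndex : Fin 2 → Fin 2 → Fin 2 → Fin 2 → Fin 3 → Fin 3
  | 0, 1, 1, 0 => ![0, 2, 1]
  | 0, 1, 1, 1 => ![2, 0, 1]
  | 1, 0, 1, 1 => ![2, 1, 0]
  | 1, 1, 0, 1 => ![1, 0, 2]
  | 1, 1, 1, 0 => ![1, 2, 0]
  | _, _, _, _ => ![0, 1, 2]

/-- The signs of the signed permutation matrices that represent the invertible `2 × 2` matrices
over `𝔽₂`. -/
def permSign : Fin 2 → Fin 2 → Fin 2 → Fin 2 → Fin 3 → ℤ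
  | 0, 1, 1, 0 => ![-1, -1, -1]
  | 0, 1, 1, 1 => ![-1, -1, 1]
  | 1, 0, 1, 1 => ![1, -1, 1]
  | 1, 1, 0, 1 => ![1, 1, -1]
  | 1, 1, 1, 0 => ![-1, 1, -1]
  | _, _, _, _ => ![1, 1, 1]

/-- The signs of the diagonal matrices that represent the transvections fixing the first basis
vector. -/
def diagSign : Fin 2 → Fin 2 → Fin 3 → ℤ
  | 0, 0 => ![1, 1, 1]
  | 0, 1 => ![-1, -1, 1]
  | 1, 0 => ![-1, 1, -1]
  | 1, 1 => ![1, -1, -1]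

/-- The entries of the matrix left after splitting off a power of the Singer cycle. -/
def stabPart (k : Fin 7) (g : Matrix (Fin 3) (Fin 3) (ZMod 2)) (i j : Fin 3) : Fin 2 :=
  singerInv k i 0 * g 0 j + singerInv k i 1 * g 1 j + singerInv k i 2 * g 2 j

/-- Twice the matrix representing the product of a power of the Singer cycle and a matrix fixing
the first basis vector, the latter being represented by a signed permutation matrix. -/
def singerMul (k : Fin 7) (s : Fin 3 → Fin 3 → Fin 2) : Matrix (Fin 3) (Fin 3) KleinInt :=
  .of fun i j =>
    let z := singerRep k i (permIndex (s 1 1) (s 1 2) (s 2 1) (s 2 2) j)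
    let e := permSign (s 1 1) (s 1 2) (s 2 1) (s 2 2) j * diagSign (s 0 1) (s 0 2) j
    ⟨e * z.re, e * z.im⟩

/-- Twice the image of a matrix under Klein's representation of `SL₃(𝔽₂)`. -/
def klein (g : Matrix (Fin 3) (Fin 3) (ZMod 2)) : Matrix (Fin 3) (Fin 3) KleinInt :=
  singerMul (singerIndex (g 0 0) (g 1 0) (g 2 0))
    (stabPart (singerIndex (g 0 0) (g 1 0) (g 2 0)) g)

/-- The quantifier over matrices in a form fit for evaluation. -/
theorem forall_matrix_iff {P : Matrix (Fin 3) (Fin 3) (ZMod 2) → Prop} :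
    (∀ g, P g) ↔ ∀ a b c d e f p q r : Fin 2, P !![a, b, c; d, e, f; p, q, r] :=
  ⟨fun h _ _ _ _ _ _ _ _ _ => h _, fun h g => by rw [Matrix.eta_fin_three g]; apply h⟩

/-- An element generating `SL₃(𝔽₂)` together with `singer`. -/
def shear : Matrix (Fin 3) (Fin 3) (ZMod 2) := !![1, 1, 0; 0, 1, 0; 0, 0, 1]

theorem mem_closure_of_det_eq_one (g : Matrix (Fin 3) (Fin 3) (ZMod 2)) (hg : g.det = 1) :
    g ∈ Submonoid.closure {singer, shear} := by
  have hc : singer ∈ Submonoid.closure {singer, shear} := Submonoid.subset_closure (by simp)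
  have ht : shear ∈ Submonoid.closure {singer, shear} := Submonoid.subset_closure (by simp)
  have zmod_two (x : ZMod 2) : x = 0 ∨ x = 1 := by revert x; decide
  refine Matrix.diagonal_transvection_induction_of_det_ne_zero
    (· ∈ Submonoid.closure {singer, shear}) g (by simp [hg]) ?_ ?_
    fun A B _ _ hA hB => mul_mem hA hB
  · intro D hD
    have : D = fun _ => 1 := by
      funext i
      rw [Matrix.det_diagonal, Finset.prod_ne_zero_iff] at hD
      exact (zmod_two (D i)).resolve_left (hD i (Finset.mem_univ i))
    simp [this]
  · rintro ⟨i, j, hij, c⟩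
    obtain rfl | rfl := zmod_two c
    · simp [Matrix.TransvectionStruct.toMatrix]
    have key : Matrix.transvection i j (1 : ZMod 2) ∈
        [shear, singer * (shear * (singer * (shear * (singer * (singer * singer))))),
          singer * (singer * (shear * (singer * (shear * (singer * singer))))),
          singer * (shear * (singer * (shear * (singer * (shear * (singer * singer)))))),
          singer * (singer * (shear * (singer * (shear * (singer * (shear * singer)))))),
          singer * (singer * (singer * (shear * (singer * (shear * singer)))))] := by
      revert i j
      decide +kernel
    rw [Matrix.TransvectionStruct.toMatrix]
    generalize Matrix.transvection i j (1 : ZMod 2) = m at key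
    have h₁ {x} (hx : x ∈ Submonoid.closure {singer, shear}) :
        singer * x ∈ Submonoid.closure {singer, shear} := mul_mem hc hx
    have h₂ {x} (hx : x ∈ Submonoid.closure {singer, shear}) :
        shear * x ∈ Submonoid.closure {singer, shear} := mul_mem ht hx
    simp only [List.mem_cons, List.not_mem_nil, or_false] at key
    rcases key with h | h | h | h | h | h <;> subst h
    · exact ht
    · exact h₁ (h₂ (h₁ (h₂ (h₁ (h₁ hc)))))
    · exact h₁ (h₁ (h₂ (h₁ (h₂ (h₁ hc)))))
    · exact h₁ (h₂ (h₁ (h₂ (h₁ (h₂ (h₁ hc))))))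
    · exact h₁ (h₁ (h₂ (h₁ (h₂ (h₁ (h₂ hc))))))
    · exact h₁ (h₁ (h₁ (h₂ (h₁ (h₂ hc)))))

/-- The determinant as an explicit polynomial. -/
def detPoly (g : Matrix (Fin 3) (Fin 3) (ZMod 2)) : ZMod 2 :=
  g 0 0 * g 1 1 * g 2 2 - g 0 0 * g 1 2 * g 2 1 - g 0 1 * g 1 0 * g 2 2 + g 0 1 * g 1 2 * g 2 0
    + g 0 2 * g 1 0 * g 2 1 - g 0 2 * g 1 1 * g 2 0

theorem eq_one_of_klein (g : Matrix (Fin 3) (Fin 3) (ZMod 2)) (hg : g.det = 1)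
    (h : klein g = .of fun i j => ⟨if i = j then 2 else 0, 0⟩) : g = 1 := by
  suffices ∀ g, detPoly g = 1 → klein g = (.of fun i j => ⟨if i = j then 2 else 0, 0⟩) → g = 1 from
    this g (by rw [← hg, Matrix.det_fin_three, detPoly]) h
  rw [forall_matrix_iff]
  decide +kernel

theorem klein_shear_mul (g : Matrix (Fin 3) (Fin 3) (ZMod 2)) (hg : g.det = 1) :
    klein shear * klein g = (2 : ℤ) • klein (shear * g) := by
  have main : ∀ g, detPoly g = 1 → klein (shear * g) = .of fun i j =>
      ⟨![-1, 1, -1] i * (klein g i j).re, ![-1, 1, -1] i * (klein g i j).im⟩ := by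
    rw [forall_matrix_iff]
    decide +kernel
  have hs : klein shear = !![⟨-2, 0⟩, 0, 0; 0, ⟨2, 0⟩, 0; 0, 0, ⟨-2, 0⟩] := by decide +kernel
  rw [main g (by rw [← hg, Matrix.det_fin_three, detPoly]), hs]
  ext i j <;> fin_cases i <;> simp [Matrix.mul_apply, Fin.sum_univ_three,
    QuadraticAlgebra.re_ofNat, QuadraticAlgebra.im_ofNat]

theorem klein_singer : klein singer = singerRep 1 := by decide +kernel

theorem singerIndex_mul (g : Matrix (Fin 3) (Fin 3) (ZMod 2)) (hg : g.det = 1) :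
    singerIndex ((singer * g) 0 0) ((singer * g) 1 0) ((singer * g) 2 0) =
      singerIndex (g 0 0) (g 1 0) (g 2 0) + 1 := by
  have main : ∀ a b c : Fin 2, ¬ (a = 0 ∧ b = 0 ∧ c = 0) →
      singerIndex c a (b + c) = singerIndex a b c + 1 := by decide +kernel
  have h0 : (singer * g) 0 0 = g 2 0 := by simp [singer, Matrix.mul_apply, Fin.sum_univ_three]
  have h1 : (singer * g) 1 0 = g 0 0 := by simp [singer, Matrix.mul_apply, Fin.sum_univ_three]
  have h2 : (singer * g) 2 0 = g 1 0 + g 2 0 := by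
    simp [singer, Matrix.mul_apply, Fin.sum_univ_three]
  rw [h0, h1, h2]
  refine main _ _ _ fun ⟨h0, h1, h2⟩ => ?_
  change (g 0 0 : ZMod 2) = 0 at h0
  change (g 1 0 : ZMod 2) = 0 at h1
  change (g 2 0 : ZMod 2) = 0 at h2
  simp [Matrix.det_fin_three, h0, h1, h2] at hg

theorem stabPart_mul (k : Fin 7) (g : Matrix (Fin 3) (Fin 3) (ZMod 2)) :
    stabPart (k + 1) (singer * g) = stabPart k g := by
  have main : ∀ k, singerInv (k + 1) * singer = singerInv k := by decide +kernel
  have stabPart_eq (k) (g : Matrix (Fin 3) (Fin 3) (ZMod 2)) :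
      stabPart k g = singerInv k * g := by
    funext i j
    rw [Matrix.mul_apply, Fin.sum_univ_three]
    rfl
  rw [stabPart_eq, stabPart_eq, ← main k, Matrix.mul_assoc]

theorem singerMul_succ (k : Fin 7) (s : Fin 3 → Fin 3 → Fin 2) :
    singerRep 1 * singerMul k s = (2 : ℤ) • singerMul (k + 1) s := by
  have main : ∀ k, singerRep 1 * singerRep k = (2 : ℤ) • singerRep (k + 1) := by
    decide +kernel
  ext i j
  all_goals
    simp only [singerMul, Matrix.mul_apply, Fin.sum_univ_three, Matrix.of_apply,
      Matrix.smul_apply, QuadraticAlgebra.re_add, QuadraticAlgebra.im_add, QuadraticAlgebra.re_mul,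
      QuadraticAlgebra.im_mul, QuadraticAlgebra.re_smul, QuadraticAlgebra.im_smul, smul_eq_mul]
    generalize permSign _ _ _ _ j * diagSign _ _ j = e
    generalize permIndex _ _ _ _ j = l
    have h := congrFun₂ (main k) i l
    simp only [Matrix.mul_apply, Fin.sum_univ_three, Matrix.smul_apply, QuadraticAlgebra.ext_iff,
      QuadraticAlgebra.re_add, QuadraticAlgebra.im_add, QuadraticAlgebra.re_mul,
      QuadraticAlgebra.im_mul, QuadraticAlgebra.re_smul, QuadraticAlgebra.im_smul,
      smul_eq_mul] at h
  · linear_combination e * h.1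
  · linear_combination e * h.2

theorem klein_singer_mul (g : Matrix (Fin 3) (Fin 3) (ZMod 2)) (hg : g.det = 1) :
    klein singer * klein g = (2 : ℤ) • klein (singer * g) := by
  rw [klein_singer, klein, singerMul_succ, klein, singerIndex_mul g hg, stabPart_mul]

/-- The embedding of `ℤ[(-1 + √-7) / 2]` into the complex numbers. -/
noncomputable def toComplex : KleinInt →ₐ[ℤ] ℂ :=
  QuadraticAlgebra.lift ⟨(-1 + √7 * Complex.I) / 2, by
    have : (√7 : ℂ) ^ 2 = 7 := by norm_cast; simp
    simp only [zsmul_eq_mul]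
    push_cast
    linear_combination (√7 : ℂ) ^ 2 / 4 * Complex.I_sq - this / 4⟩

theorem toComplex_apply (z : KleinInt) :
    toComplex z = z.re + z.im * ((-1 + √7 * Complex.I) / 2) := by
  simp [toComplex]

theorem toComplex_injective : Function.Injective toComplex := by
  refine (injective_iff_map_eq_zero _).2 fun z hz => ?_
  rw [toComplex_apply, Complex.ext_iff] at hz
  simp at hz
  obtain ⟨h₁, h₂⟩ := hz
  rw [h₂] at h₁
  ext
  · simpa using h₁
  · exact h₂

theorem star_toComplex (z : KleinInt) : star (toComplex z) = toComplex (star z) := by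
  simp only [toComplex_apply, QuadraticAlgebra.re_star, QuadraticAlgebra.im_star]
  simp only [Complex.star_def, map_add, map_mul, map_div₀, map_neg, map_one, Complex.conj_I,
    Complex.conj_ofReal, map_intCast, map_ofNat]
  push_cast
  ring

/-- Klein's representation of `SL₃(𝔽₂)`, as a map on all matrices. -/
noncomputable def complexKlein (g : Matrix (Fin 3) (Fin 3) (ZMod 2)) : Matrix (Fin 3) (Fin 3) ℂ :=
  (1 / 2 : ℂ) • toComplex.mapMatrix (klein g)

theorem complexKlein_one : complexKlein 1 = 1 := by
  have : klein 1 = (2 : ℤ) • 1 := by decide +kernel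
  rw [complexKlein, this, map_zsmul, map_one]
  module

theorem eq_one_of_complexKlein (g : Matrix (Fin 3) (Fin 3) (ZMod 2)) (hg : g.det = 1)
    (h : complexKlein g = 1) : g = 1 := by
  refine eq_one_of_klein g hg ?_
  ext1 i j
  apply toComplex_injective
  have := congrFun₂ h i j
  simp only [complexKlein, AlgHom.mapMatrix_apply, Matrix.smul_apply, Matrix.map_apply,
    Matrix.one_apply, smul_eq_mul] at this
  rw [Matrix.of_apply]
  have cast (n : ℤ) : toComplex ⟨n, 0⟩ = n := by rw [toComplex_apply]; simp
  rw [cast]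
  split_ifs at this ⊢ <;> push_cast <;> linear_combination 2 * this

theorem complexKlein_mem {g : Matrix (Fin 3) (Fin 3) (ZMod 2)} (hg : g = singer ∨ g = shear) :
    complexKlein g ∈ specialUnitaryGroup (Fin 3) ℂ := by
  have h₁ : klein g * (klein g)ᴴ = (4 : ℤ) • (1 : Matrix (Fin 3) (Fin 3) KleinInt) := by
    obtain rfl | rfl := hg <;> decide +kernel
  have h₂ : (klein g).det = 8 := by
    rw [Matrix.det_fin_three]
    obtain rfl | rfl := hg <;> decide +kernel
  rw [mem_specialUnitaryGroup_iff, mem_unitaryGroup_iff]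
  constructor
  · have : star (toComplex.mapMatrix (klein g)) = toComplex.mapMatrix (klein g)ᴴ := by
      ext i j
      exact star_toComplex _
    rw [complexKlein, star_smul, this, Matrix.smul_mul, Matrix.mul_smul, smul_smul,
      ← map_mul, h₁, map_zsmul, map_one]
    simp only [star_div₀, star_one, star_ofNat]
    module
  · rw [complexKlein, Matrix.det_smul, ← AlgHom.map_det, h₂, map_ofNat, Fintype.card_fin]
    norm_num

theorem complexKlein_mul {g h : Matrix (Fin 3) (Fin 3) (ZMod 2)} (hg : g = singer ∨ g = shear)
    (hh : h.det = 1) : complexKlein (g * h) = complexKlein g * complexKlein h := by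
  have : klein g * klein h = (2 : ℤ) • klein (g * h) := by
    obtain rfl | rfl := hg
    exacts [klein_singer_mul h hh, klein_shear_mul h hh]
  rw [complexKlein, complexKlein, complexKlein, Matrix.smul_mul, Matrix.mul_smul, smul_smul,
    ← map_mul, this, map_zsmul]
  module

theorem complexKlein_spec (g : Matrix (Fin 3) (Fin 3) (ZMod 2)) (hg : g.det = 1) :
    complexKlein g ∈ specialUnitaryGroup (Fin 3) ℂ ∧
      ∀ h, h.det = 1 → complexKlein (g * h) = complexKlein g * complexKlein h := by
  induction mem_closure_of_det_eq_one g hg using Submonoid.closure_induction_left with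
  | one =>
    rw [complexKlein_one]
    exact ⟨one_mem _, fun h _ => by rw [one_mul, one_mul]⟩
  | mul_left x hx y hy ih =>
    have hx' : x.det = 1 := by
      obtain rfl | rfl := hx <;> decide +kernel
    have hy' : y.det = 1 := by simpa [hx'] using hg
    rw [complexKlein_mul hx hy']
    refine ⟨mul_mem (complexKlein_mem hx) (ih hy').1, fun h hh => ?_⟩
    rw [mul_assoc, complexKlein_mul hx (by simp [hy', hh]), (ih hy').2 h hh, mul_assoc]

/-- Klein's representation: an embedding of `SL₃(𝔽₂)` into `SU(3)`. -/
noncomputable def rep : SpecialLinearGroup (Fin 3) (ZMod 2) →* specialUnitaryGroup (Fin 3) ℂ where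
  toFun g := ⟨complexKlein g, (complexKlein_spec g g.2).1⟩
  map_one' := Subtype.ext complexKlein_one
  map_mul' g h := Subtype.ext ((complexKlein_spec g g.2).2 h h.2)

theorem rep_injective : Function.Injective rep := by
  refine (injective_iff_map_eq_one _).2 fun g hg => Subtype.ext ?_
  exact eq_one_of_complexKlein g g.2 (congrArg Subtype.val hg)

end KleinInt

end KleinRepresentation

section StiefelFrame

open Matrix

variable {R : Type*} [CommRing R] {v w : Fin 3 → R}

/-- A trivialization over the unit sphere `v ⬝ᵥ w = 1` of the bundle of pairs of vectors `p`, `q`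
with `w ⬝ᵥ p = w ⬝ᵥ q = 0`, given by polynomials in the coordinates of `v` and `w`. -/
def frameMap (v w : Fin 3 → R) (x : Fin 4 → R) : (Fin 3 → R) × (Fin 3 → R) :=
  let P₁ := -w 0 * x 0
  let P₂ := w 0 * x 1 + (w 1 ^ 2 - w 2 * v 2) * x 2 + (w 1 * w 2 + w 2 * v 1) * x 3
  let q := x 1 - P₂ * v 0 * (2 - w 0 * v 0)
  let Q₁ := x 2 - P₂ * (v 1 ^ 2 - w 2 * v 2)
  let Q₂ := x 3 - P₂ * (v 2 * v 1 + w 1 * v 2)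
  (![(w 1 * v 1 + w 2 * v 2) * x 0 - v 0 * (w 1 * Q₁ + w 2 * Q₂),
    v 1 * P₁ - w 2 * P₂ + w 0 * v 0 * Q₁,
    v 2 * P₁ + w 1 * P₂ + w 0 * v 0 * Q₂],
  ![q + v 0 * (w 1 * P₁ + w 2 * P₂)
      - v 0 * (w 1 * (w 1 * Q₁ + w 2 * Q₂) + w 2 * (-v 2 * Q₁ + v 1 * Q₂)),
    -w 0 * v 0 * P₁ + (1 + w 0 * v 0) * (w 1 * Q₁ + w 2 * Q₂),
    -w 0 * v 0 * P₂ + (1 + w 0 * v 0) * (-v 2 * Q₁ + v 1 * Q₂)])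

/-- The inverse of `frameMap`. -/
def frameInv (v w : Fin 3 → R) (X : (Fin 3 → R) × (Fin 3 → R)) : Fin 4 → R :=
  let p := X.1
  let q := X.2
  let P₁ := (1 + w 0 * v 0) * (w 1 * p 1 + w 2 * p 2) - w 0 * v 0 * q 1
  let P₂ := (1 + w 0 * v 0) * (-v 2 * p 1 + v 1 * p 2) - w 0 * v 0 * q 2
  let Q₁ := w 0 * v 0 * p 1 + v 1 * q 1 - w 2 * q 2
  let Q₂ := w 0 * v 0 * p 2 + v 2 * q 1 + w 1 * q 2
  ![p 0 - v 0 * P₁ + v 0 * (w 1 * Q₁ + w 2 * Q₂),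
    q 0 - v 0 * (w 1 * P₁ + w 2 * P₂)
      + v 0 * (w 1 * (w 1 * Q₁ + w 2 * Q₂) + w 2 * (-v 2 * Q₁ + v 1 * Q₂))
      + P₂ * v 0 * (2 - w 0 * v 0),
    Q₁ + P₂ * (v 1 ^ 2 - w 2 * v 2),
    Q₂ + P₂ * (v 2 * v 1 + w 1 * v 2)]

theorem dotProduct_frameMap (h : w ⬝ᵥ v = 1) (x : Fin 4 → R) :
    w ⬝ᵥ (frameMap v w x).1 = 0 ∧ w ⬝ᵥ (frameMap v w x).2 = 0 := by
  simp only [dotProduct, Fin.sum_univ_three] at h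
  simp only [frameMap, dotProduct, Fin.sum_univ_three, cons_val]
  constructor
  · ring
  · set P₂ := w 0 * x 1 + (w 1 ^ 2 - w 2 * v 2) * x 2 + (w 1 * w 2 + w 2 * v 1) * x 3 with hP₂
    clear_value P₂
    linear_combination -hP₂ - P₂ * (1 - w 0 * v 0 + w 1 * v 1 + w 2 * v 2) * h

theorem frameInv_frameMap (h : w ⬝ᵥ v = 1) (x : Fin 4 → R) :
    frameInv v w (frameMap v w x) = x := by
  simp only [dotProduct, Fin.sum_univ_three] at h
  simp only [frameInv, frameMap, cons_val]
  generalize w 0 * x 1 + (w 1 ^ 2 - w 2 * v 2) * x 2 + (w 1 * w 2 + w 2 * v 1) * x 3 = P₂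
  obtain ⟨Q₁, hQ₁⟩ : ∃ Q₁, Q₁ = x 2 - P₂ * (v 1 ^ 2 - w 2 * v 2) := ⟨_, rfl⟩
  obtain ⟨Q₂, hQ₂⟩ : ∃ Q₂, Q₂ = x 3 - P₂ * (v 2 * v 1 + w 1 * v 2) := ⟨_, rfl⟩
  rw [← hQ₁, ← hQ₂]
  obtain ⟨P₁, hP₁⟩ : ∃ P₁, P₁ = -w 0 * x 0 := ⟨_, rfl⟩
  rw [← hP₁]
  have h₁ : (1 + w 0 * v 0) * (w 1 * (v 1 * P₁ - w 2 * P₂ + w 0 * v 0 * Q₁)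
      + w 2 * (v 2 * P₁ + w 1 * P₂ + w 0 * v 0 * Q₂))
      - w 0 * v 0 * (-w 0 * v 0 * P₁ + (1 + w 0 * v 0) * (w 1 * Q₁ + w 2 * Q₂)) = P₁ := by
    linear_combination (P₁ * (1 + w 0 * v 0)) * h
  have h₂ : (1 + w 0 * v 0) * (-v 2 * (v 1 * P₁ - w 2 * P₂ + w 0 * v 0 * Q₁)
      + v 1 * (v 2 * P₁ + w 1 * P₂ + w 0 * v 0 * Q₂))
      - w 0 * v 0 * (-w 0 * v 0 * P₂ + (1 + w 0 * v 0) * (-v 2 * Q₁ + v 1 * Q₂)) = P₂ := by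
    linear_combination (P₂ * (1 + w 0 * v 0)) * h
  have h₃ : w 0 * v 0 * (v 1 * P₁ - w 2 * P₂ + w 0 * v 0 * Q₁)
      + v 1 * (-w 0 * v 0 * P₁ + (1 + w 0 * v 0) * (w 1 * Q₁ + w 2 * Q₂))
      - w 2 * (-w 0 * v 0 * P₂ + (1 + w 0 * v 0) * (-v 2 * Q₁ + v 1 * Q₂)) = Q₁ := by
    linear_combination (Q₁ * (1 + w 0 * v 0)) * h
  have h₄ : w 0 * v 0 * (v 2 * P₁ + w 1 * P₂ + w 0 * v 0 * Q₂)
      + v 2 * (-w 0 * v 0 * P₁ + (1 + w 0 * v 0) * (w 1 * Q₁ + w 2 * Q₂))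
      + w 1 * (-w 0 * v 0 * P₂ + (1 + w 0 * v 0) * (-v 2 * Q₁ + v 1 * Q₂)) = Q₂ := by
    linear_combination (Q₂ * (1 + w 0 * v 0)) * h
  rw [h₁, h₂, h₃, h₄]
  ext i
  fin_cases i
  · change _ - v 0 * P₁ + _ = x 0
    linear_combination -v 0 * hP₁ + x 0 * h
  · change _ - _ + _ + _ = x 1
    ring
  · change Q₁ + _ = x 2
    linear_combination hQ₁
  · change Q₂ + _ = x 3
    linear_combination hQ₂

theorem frameMap_frameInv (h : w ⬝ᵥ v = 1) {p q : Fin 3 → R} (hp : w ⬝ᵥ p = 0)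
    (hq : w ⬝ᵥ q = 0) : frameMap v w (frameInv v w (p, q)) = (p, q) := by
  simp only [dotProduct, Fin.sum_univ_three] at h hp hq
  simp only [frameInv, frameMap, cons_val]
  obtain ⟨P₁, hP₁⟩ : ∃ P₁, P₁ = (1 + w 0 * v 0) * (w 1 * p 1 + w 2 * p 2) - w 0 * v 0 * q 1 :=
    ⟨_, rfl⟩
  obtain ⟨P₂, hP₂⟩ : ∃ P₂, P₂ = (1 + w 0 * v 0) * (-v 2 * p 1 + v 1 * p 2) - w 0 * v 0 * q 2 :=
    ⟨_, rfl⟩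
  obtain ⟨Q₁, hQ₁⟩ : ∃ Q₁, Q₁ = w 0 * v 0 * p 1 + v 1 * q 1 - w 2 * q 2 := ⟨_, rfl⟩
  obtain ⟨Q₂, hQ₂⟩ : ∃ Q₂, Q₂ = w 0 * v 0 * p 2 + v 2 * q 1 + w 1 * q 2 := ⟨_, rfl⟩
  rw [← hP₁, ← hP₂, ← hQ₁, ← hQ₂]
  have hp₁ : v 1 * P₁ - w 2 * P₂ + w 0 * v 0 * Q₁ = p 1 := by
    linear_combination v 1 * hP₁ - w 2 * hP₂ + w 0 * v 0 * hQ₁ + p 1 * (1 + w 0 * v 0) * h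
  have hp₂ : v 2 * P₁ + w 1 * P₂ + w 0 * v 0 * Q₂ = p 2 := by
    linear_combination v 2 * hP₁ + w 1 * hP₂ + w 0 * v 0 * hQ₂ + p 2 * (1 + w 0 * v 0) * h
  have hq₁ : -w 0 * v 0 * P₁ + (1 + w 0 * v 0) * (w 1 * Q₁ + w 2 * Q₂) = q 1 := by
    linear_combination -w 0 * v 0 * hP₁ + (1 + w 0 * v 0) * (w 1 * hQ₁ + w 2 * hQ₂)
      + q 1 * (1 + w 0 * v 0) * h
  have hq₂ : -w 0 * v 0 * P₂ + (1 + w 0 * v 0) * (-v 2 * Q₁ + v 1 * Q₂) = q 2 := by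
    linear_combination -w 0 * v 0 * hP₂ + (1 + w 0 * v 0) * (-v 2 * hQ₁ + v 1 * hQ₂)
      + q 2 * (1 + w 0 * v 0) * h
  have hP₁' : -w 0 * (p 0 - v 0 * P₁ + v 0 * (w 1 * Q₁ + w 2 * Q₂)) = P₁ := by
    linear_combination -hp - w 1 * hp₁ - w 2 * hp₂ + P₁ * h
  have hP₂' : w 0 * (q 0 - v 0 * (w 1 * P₁ + w 2 * P₂)
      + v 0 * (w 1 * (w 1 * Q₁ + w 2 * Q₂) + w 2 * (-v 2 * Q₁ + v 1 * Q₂))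
      + P₂ * v 0 * (2 - w 0 * v 0)) + (w 1 ^ 2 - w 2 * v 2) * (Q₁ + P₂ * (v 1 ^ 2 - w 2 * v 2))
      + (w 1 * w 2 + w 2 * v 1) * (Q₂ + P₂ * (v 2 * v 1 + w 1 * v 2)) = P₂ := by
    linear_combination hq + w 1 * hq₁ + w 2 * hq₂
      + P₂ * (1 - w 0 * v 0 + w 1 * v 1 + w 2 * v 2) * h
  rw [hP₁', hP₂', add_sub_cancel_right, add_sub_cancel_right, hp₁, hp₂, hq₁, hq₂]
  refine Prod.ext ?_ ?_ <;> ext i <;> fin_cases i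
  · change _ - _ = p 0
    linear_combination (v 0 * (w 1 * Q₁ + w 2 * Q₂) + p 0) * h
      - v 0 * (w 1 * hp₁ + w 2 * hp₂ + hp)
  · rfl
  · rfl
  · change _ - _ = q 0
    ring
  · rfl
  · rfl

theorem frameMap_smul (t : R) (x : Fin 4 → R) : frameMap v w (t • x) = t • frameMap v w x := by
  refine Prod.ext ?_ ?_ <;> ext i <;> fin_cases i <;> simp [frameMap] <;> ring

theorem frameInv_smul (t : R) (X : (Fin 3 → R) × (Fin 3 → R)) :
    frameInv v w (t • X) = t • frameInv v w X := by
  ext i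
  fin_cases i <;> simp [frameInv] <;> ring

end StiefelFrame

section SpecialUnitary

open Matrix
open scoped ComplexOrder

theorem mulVec_cross_mulVec {R : Type*} [CommRing R] (A : Matrix (Fin 3) (Fin 3) R)
    (v w : Fin 3 → R) : (A *ᵥ v) ⨯₃ (A *ᵥ w) = A.adjugateᵀ *ᵥ (v ⨯₃ w) := by
  rw [adjugate_fin_three]
  ext i
  fin_cases i <;> simp [crossProduct, mulVec, dotProduct, Fin.sum_univ_three] <;> ring

theorem eq_one_of_mem_specialUnitaryGroup {A : Matrix (Fin 3) (Fin 3) ℂ}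
    (hA : A ∈ specialUnitaryGroup (Fin 3) ℂ) {v p : Fin 3 → ℂ} (hv : v ≠ 0) (hp : p ≠ 0)
    (hvp : star v ⬝ᵥ p = 0) (hAv : A *ᵥ v = v) (hAp : A *ᵥ p = p) : A = 1 := by
  obtain ⟨hA, hdet⟩ := mem_specialUnitaryGroup_iff.1 hA
  have adj : A.adjugate = star A := by
    have := congrArg (star A * ·) A.mul_adjugate
    simpa [hdet, ← Matrix.mul_assoc, mem_unitaryGroup_iff'.1 hA] using this
  set n := star (v ⨯₃ p) with hn
  have hAn : A *ᵥ n = n := by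
    have := congrArg star (mulVec_cross_mulVec A v p)
    have hT : ((star A)ᵀ)ᴴ = Aᵀ := by
      ext i j
      simp [star_apply]
    rw [adj, hAv, hAp, star_mulVec, ← hn, hT, vecMul_transpose] at this
    exact this.symm
  have hn0 : n ⬝ᵥ (v ⨯₃ p) ≠ 0 := by
    rw [Ne, dotProduct_star_self_eq_zero]
    rw [← Ne, crossProduct_ne_zero_iff_linearIndependent, LinearIndependent.pair_iff]
    intro s t h
    have h' := congrArg (star v ⬝ᵥ ·) h
    simp only [dotProduct_add, dotProduct_smul, hvp, smul_zero, add_zero, dotProduct_zero,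
      smul_eq_zero, dotProduct_star_self_eq_zero, hv, or_false] at h'
    simpa [h', hp] using h
  rw [triple_product_eq_det] at hn0
  have key : A * (of ![n, v, p])ᵀ = (of ![n, v, p])ᵀ := by
    ext i j
    change (A *ᵥ of ![n, v, p] j) i = of ![n, v, p] j i
    fin_cases j
    exacts [congrFun hAn i, congrFun hAv i, congrFun hAp i]
  refine (IsUnit.mul_eq_right ?_).1 key
  rw [isUnit_iff_isUnit_det, det_transpose]
  exact hn0.isUnit

theorem dotProduct_star_mulVec {A : Matrix (Fin 3) (Fin 3) ℂ}
    (hA : A ∈ specialUnitaryGroup (Fin 3) ℂ) (v w : Fin 3 → ℂ) :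
    star (A *ᵥ v) ⬝ᵥ (A *ᵥ w) = star v ⬝ᵥ w := by
  rw [star_mulVec, ← dotProduct_mulVec, mulVec_mulVec, ← star_eq_conjTranspose,
    mem_unitaryGroup_iff'.1 (mem_specialUnitaryGroup_iff.1 hA).1, one_mulVec]

theorem mulVec_eq_self_of_smul {A : Matrix (Fin 3) (Fin 3) ℂ}
    (hA : A ∈ specialUnitaryGroup (Fin 3) ℂ) {p : Fin 3 → ℂ} {t : ℝ} (ht : 0 < t)
    (h : A *ᵥ p = t • p) : A *ᵥ p = p := by
  by_cases hp : p = 0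
  · rw [hp, mulVec_zero]
  have h₂ := dotProduct_star_mulVec hA p p
  rw [h, star_smul, smul_dotProduct, dotProduct_smul, star_trivial, smul_smul,
    ← sub_eq_zero] at h₂
  nth_rw 2 [← one_smul ℝ (star p ⬝ᵥ p)] at h₂
  rw [← sub_smul, smul_eq_zero, dotProduct_star_self_eq_zero] at h₂
  obtain rfl : t = 1 := by nlinarith [h₂.resolve_right hp]
  rw [h, one_smul]

end SpecialUnitary

section SphereAction

open scoped ContDiff

/-- Data inducing an action of a group `G` on a product of unit spheres: an action on the first
factor by isometries and an action, covering it, on the trivial vector bundle whose fibre is the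
second vector space. -/
structure SphereBundleAction (G V W : Type*) [Group G] [NormedAddCommGroup V] [NormedSpace ℝ V]
    [NormedAddCommGroup W] [NormedSpace ℝ W] where
  /-- The action on the base. -/
  base : G → V → V
  /-- The action on the fibres. -/
  fiber : G → V → W → W
  contDiff_base (g : G) : ContDiff ℝ ∞ (base g)
  contDiff_fiber (g : G) : ContDiff ℝ ∞ fun p : V × W => fiber g p.1 p.2
  norm_base (g : G) (v : V) : ‖base g v‖ = ‖v‖
  base_one (v : V) : base 1 v = v
  base_mul (g h : G) (v : V) : base (g * h) v = base g (base h v)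
  fiber_smul (g : G) (v : V) (t : ℝ) (x : W) : fiber g v (t • x) = t • fiber g v x
  fiber_one (v : V) (x : W) : ‖v‖ = 1 → fiber 1 v x = x
  fiber_mul (g h : G) (v : V) (x : W) :
    ‖v‖ = 1 → fiber (g * h) v x = fiber g (base h v) (fiber h v x)

namespace SphereBundleAction

variable {G : Type*} [Group G]

theorem fiber_ne_zero {V W : Type*} [NormedAddCommGroup V] [NormedSpace ℝ V]
    [NormedAddCommGroup W] [NormedSpace ℝ W] (A : SphereBundleAction G V W) (g : G) {v : V} {x : W}
    (hv : ‖v‖ = 1) (hx : x ≠ 0) : A.fiber g v x ≠ 0 := by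
  intro h
  refine hx ?_
  have zero (v) : A.fiber g⁻¹ v 0 = 0 := by simpa using A.fiber_smul g⁻¹ v 0 0
  rw [← A.fiber_one v x hv, ← inv_mul_cancel g, A.fiber_mul _ _ _ _ hv, h, zero]

variable {m n : ℕ}
  (A : SphereBundleAction G (EuclideanSpace ℝ (Fin (m + 1))) (EuclideanSpace ℝ (Fin (n + 1))))

/-- The self-map of the product of spheres induced by a group element. -/
noncomputable def toFun (g : G) (p : Sph m × Sph n) : Sph m × Sph n :=
  (⟨A.base g p.1, by simp [A.norm_base]⟩,
    ⟨‖A.fiber g p.1 p.2‖⁻¹ • A.fiber g p.1 p.2, by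
      rw [mem_sphere_zero_iff_norm]
      exact norm_smul_inv_norm (𝕜 := ℝ)
        (A.fiber_ne_zero g (norm_eq_of_mem_sphere _) (ne_zero_of_mem_unit_sphere _))⟩)

theorem contMDiff_toFun (g : G) :
    ContMDiff ((𝓡 m).prod (𝓡 n)) ((𝓡 m).prod (𝓡 n)) ∞ (A.toFun g) := by
  have (k : ℕ) : Fact (Module.finrank ℝ (EuclideanSpace ℝ (Fin (k + 1))) = k + 1) :=
    ⟨finrank_euclideanSpace_fin⟩
  have h₁ : ContMDiff ((𝓡 m).prod (𝓡 n)) 𝓘(ℝ, EuclideanSpace ℝ (Fin (m + 1))) ∞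
      fun p : Sph m × Sph n => (p.1 : EuclideanSpace ℝ (Fin (m + 1))) :=
    contMDiff_coe_sphere.comp contMDiff_fst
  have h₂ : ContMDiff ((𝓡 m).prod (𝓡 n)) 𝓘(ℝ, EuclideanSpace ℝ (Fin (n + 1))) ∞
      fun p : Sph m × Sph n => (p.2 : EuclideanSpace ℝ (Fin (n + 1))) :=
    contMDiff_coe_sphere.comp contMDiff_snd
  refine ContMDiff.prodMk ?_ ?_
  · exact ((A.contDiff_base g).contMDiff.comp h₁).codRestrict_sphere _
  · refine ContMDiff.codRestrict_sphere (fun p => ?_) _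
    have h₃ : ContDiffAt ℝ ∞ (fun p : EuclideanSpace ℝ (Fin (m + 1)) ×
        EuclideanSpace ℝ (Fin (n + 1)) => ‖A.fiber g p.1 p.2‖⁻¹ • A.fiber g p.1 p.2)
        (p.1, p.2) := by
      have h₀ := A.fiber_ne_zero g (norm_eq_of_mem_sphere p.1) (ne_zero_of_mem_unit_sphere p.2)
      have := (A.contDiff_fiber g).contDiffAt (x := ((p.1 : EuclideanSpace ℝ (Fin (m + 1))),
         (p.2 : EuclideanSpace ℝ (Fin (n + 1)))))
      exact ((this.norm ℝ h₀).inv (norm_ne_zero_iff.2 h₀)).smul this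
    exact ContMDiffAt.comp (f := fun p : Sph m × Sph n => (p.1.1, p.2.1)) p h₃.contMDiffAt
      (h₁.prodMk_space h₂ p)

theorem toFun_one (p : Sph m × Sph n) : A.toFun 1 p = p := by
  refine Prod.ext (Subtype.ext (A.base_one _)) (Subtype.ext ?_)
  change ‖A.fiber 1 p.1 p.2‖⁻¹ • A.fiber 1 p.1 p.2 = p.2
  rw [A.fiber_one _ _ (norm_eq_of_mem_sphere _), norm_eq_of_mem_sphere, inv_one, one_smul]

theorem toFun_mul (g h : G) (p : Sph m × Sph n) :
    A.toFun (g * h) p = A.toFun g (A.toFun h p) := by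
  refine Prod.ext (Subtype.ext (A.base_mul _ _ _)) (Subtype.ext ?_)
  change ‖A.fiber (g * h) p.1 p.2‖⁻¹ • A.fiber (g * h) p.1 p.2 =
    ‖A.fiber g (A.base h p.1) (‖A.fiber h p.1 p.2‖⁻¹ • A.fiber h p.1 p.2)‖⁻¹ •
      A.fiber g (A.base h p.1) (‖A.fiber h p.1 p.2‖⁻¹ • A.fiber h p.1 p.2)
  have h₀ := A.fiber_ne_zero h (norm_eq_of_mem_sphere p.1) (ne_zero_of_mem_unit_sphere p.2)
  rw [A.fiber_mul _ _ _ _ (norm_eq_of_mem_sphere _), A.fiber_smul, norm_smul, norm_inv, norm_norm,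
    mul_inv, inv_inv, smul_smul, mul_right_comm, mul_inv_cancel₀ (norm_ne_zero_iff.2 h₀), one_mul]

/-- The induced action by homeomorphisms. -/
noncomputable def toHom : G →* (Sph m × Sph n ≃ₜ Sph m × Sph n) where
  toFun g :=
    { toFun := A.toFun g
      invFun := A.toFun g⁻¹
      left_inv p := by rw [← toFun_mul, inv_mul_cancel, toFun_one]
      right_inv p := by rw [← toFun_mul, mul_inv_cancel, toFun_one]
      continuous_toFun := (A.contMDiff_toFun g).continuous
      continuous_invFun := (A.contMDiff_toFun g⁻¹).continuous }
  map_one' := Homeomorph.ext A.toFun_one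
  map_mul' g h := Homeomorph.ext (A.toFun_mul g h)

theorem toHom_free (g : G) (free : ∀ v x, ‖v‖ = 1 → x ≠ 0 → ∀ t : ℝ, 0 < t → A.base g v = v →
    A.fiber g v x = t • x → g = 1) (p : Sph m × Sph n) (h : A.toHom g p = p) : g = 1 := by
  have h₀ := A.fiber_ne_zero g (norm_eq_of_mem_sphere p.1) (ne_zero_of_mem_unit_sphere p.2)
  have h₂ : ‖A.fiber g p.1 p.2‖⁻¹ • A.fiber g p.1 p.2 = p.2 := congrArg (fun p => p.2.1) h
  refine free _ _ (norm_eq_of_mem_sphere p.1) (ne_zero_of_mem_unit_sphere p.2) _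
    (norm_pos_iff.2 h₀) (congrArg (fun p => p.1.1) h) ?_
  rwa [inv_smul_eq_iff₀ (norm_ne_zero_iff.2 h₀)] at h₂

end SphereBundleAction

end SphereAction

section StiefelAction

open Matrix
open scoped ContDiff

variable {E : Type*} [NormedAddCommGroup E] [NormedSpace ℝ E]

theorem ContDiff.frameMap {v w : E → Fin 3 → ℂ} {x : E → Fin 4 → ℂ} (hv : ContDiff ℝ ∞ v)
    (hw : ContDiff ℝ ∞ w) (hx : ContDiff ℝ ∞ x) :
    ContDiff ℝ ∞ fun a => frameMap (v a) (w a) (x a) := by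
  rw [contDiff_pi] at hv hw hx
  refine ContDiff.prodMk ?_ ?_ <;> refine contDiff_pi.2 fun i => ?_ <;> fin_cases i <;>
    dsimp [_root_.frameMap] <;> fun_prop

theorem ContDiff.frameInv {v w : E → Fin 3 → ℂ} {X : E → (Fin 3 → ℂ) × (Fin 3 → ℂ)}
    (hv : ContDiff ℝ ∞ v) (hw : ContDiff ℝ ∞ w) (hX : ContDiff ℝ ∞ X) :
    ContDiff ℝ ∞ fun a => frameInv (v a) (w a) (X a) := by
  have hp := hX.fst
  have hq := hX.snd
  rw [contDiff_pi] at hv hw hp hq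
  refine contDiff_pi.2 fun i => ?_
  fin_cases i <;> dsimp [_root_.frameInv] <;> fun_prop

theorem ContDiff.star_pi {v : E → Fin 3 → ℂ} (hv : ContDiff ℝ ∞ v) :
    ContDiff ℝ ∞ fun a => star (v a) := by
  rw [contDiff_pi] at hv ⊢
  exact fun i => Complex.conjCLE.contDiff.comp (hv i)

theorem ContDiff.mulVec {v : E → Fin 3 → ℂ} (hv : ContDiff ℝ ∞ v) (A : Matrix (Fin 3) (Fin 3) ℂ) :
    ContDiff ℝ ∞ fun a => A *ᵥ v a :=
  (A.mulVecLin.restrictScalars ℝ).toContinuousLinearMap.contDiff.comp hv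


/-- The identification of `ℝ⁶` with `ℂ³`. -/
noncomputable def realSixEquiv : EuclideanSpace ℝ (Fin 6) ≃L[ℝ] (Fin 3 → ℂ) :=
  LinearEquiv.toContinuousLinearEquiv
    { toFun v := ![⟨v 0, v 1⟩, ⟨v 2, v 3⟩, ⟨v 4, v 5⟩]
      invFun z := !₂[(z 0).re, (z 0).im, (z 1).re, (z 1).im, (z 2).re, (z 2).im]
      map_add' v w := by ext i; fin_cases i <;> rfl
      map_smul' t v := by ext i; fin_cases i <;> apply Complex.ext <;> simp
      left_inv v := by ext i; fin_cases i <;> rfl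
      right_inv z := by ext i; fin_cases i <;> rfl }

theorem dotProduct_star_realSixEquiv (v : EuclideanSpace ℝ (Fin 6)) :
    star (realSixEquiv v) ⬝ᵥ realSixEquiv v = (‖v‖ ^ 2 : ℝ) := by
  rw [EuclideanSpace.real_norm_sq_eq, Fin.sum_univ_six]
  change star ![(⟨v 0, v 1⟩ : ℂ), ⟨v 2, v 3⟩, ⟨v 4, v 5⟩] ⬝ᵥ
    ![(⟨v 0, v 1⟩ : ℂ), ⟨v 2, v 3⟩, ⟨v 4, v 5⟩] = _
  apply Complex.ext <;> simp [-Complex.ofReal_add, -Complex.ofReal_pow, dotProduct,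
    Fin.sum_univ_three] <;> ring

/-- An identification of `ℝ⁸` with `ℂ⁴`. -/
noncomputable def realEightEquiv : EuclideanSpace ℝ (Fin 8) ≃L[ℝ] (Fin 4 → ℂ) :=
  ContinuousLinearEquiv.ofFinrankEq (by simp [Module.finrank_pi_fintype])

/-- The action of a subgroup of `SU(3)` on the trivialized bundle of pairs of complex tangent
vectors. -/
noncomputable def stiefelAction {G : Type*} [Group G] (ρ : G →* specialUnitaryGroup (Fin 3) ℂ) :
    SphereBundleAction G (EuclideanSpace ℝ (Fin 6)) (EuclideanSpace ℝ (Fin 8)) where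
  base g v := realSixEquiv.symm ((ρ g).1 *ᵥ realSixEquiv v)
  fiber g v x :=
    let X := frameMap (realSixEquiv v) (star (realSixEquiv v)) (realEightEquiv x)
    let v' := (ρ g).1 *ᵥ realSixEquiv v
    realEightEquiv.symm (frameInv v' (star v') ((ρ g).1 *ᵥ X.1, (ρ g).1 *ᵥ X.2))
  contDiff_base g := realSixEquiv.symm.contDiff.comp (realSixEquiv.contDiff.mulVec _)
  contDiff_fiber g := by
    have hv : ContDiff ℝ ∞ fun p : EuclideanSpace ℝ (Fin 6) × EuclideanSpace ℝ (Fin 8) =>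
      realSixEquiv p.1 := realSixEquiv.contDiff.comp contDiff_fst
    have hx : ContDiff ℝ ∞ fun p : EuclideanSpace ℝ (Fin 6) × EuclideanSpace ℝ (Fin 8) =>
      realEightEquiv p.2 := realEightEquiv.contDiff.comp contDiff_snd
    have hX := hv.frameMap hv.star_pi hx
    have hv' := hv.mulVec (ρ g).1
    exact realEightEquiv.symm.contDiff.comp
      (hv'.frameInv hv'.star_pi ((hX.fst.mulVec _).prodMk (hX.snd.mulVec _)))
  norm_base g v := by
    have := dotProduct_star_realSixEquiv (realSixEquiv.symm ((ρ g).1 *ᵥ realSixEquiv v))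
    rw [ContinuousLinearEquiv.apply_symm_apply, dotProduct_star_mulVec (ρ g).2,
      dotProduct_star_realSixEquiv, Complex.ofReal_inj, sq_eq_sq₀ (norm_nonneg _) (norm_nonneg _)]
      at this
    exact this.symm
  base_one v := by simp
  base_mul g h v := by simp
  fiber_smul g v t x := by
    have smul (t : ℝ) {n : ℕ} (x : Fin n → ℂ) : t • x = (t : ℂ) • x := rfl
    have smul' (t : ℂ) (p q : Fin 3 → ℂ) : (t • p, t • q) = t • (p, q) := rfl
    rw [map_smul, smul, frameMap_smul]
    simp only [Prod.smul_fst, Prod.smul_snd, mulVec_smul]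
    rw [smul', frameInv_smul, ← smul, map_smul]
  fiber_one v x hv := by
    have h : star (realSixEquiv v) ⬝ᵥ realSixEquiv v = 1 := by
      simp [dotProduct_star_realSixEquiv, hv]
    simp [frameInv_frameMap h]
  fiber_mul g h v x hv := by
    have h₁ : star (realSixEquiv v) ⬝ᵥ realSixEquiv v = 1 := by
      simp [dotProduct_star_realSixEquiv, hv]
    have h₂ := h₁
    rw [← dotProduct_star_mulVec (ρ h).2] at h₂
    obtain ⟨hp, hq⟩ := dotProduct_frameMap h₁ (realEightEquiv x)
    rw [← dotProduct_star_mulVec (ρ h).2] at hp hq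
    simp only [map_mul, Submonoid.coe_mul, ContinuousLinearEquiv.apply_symm_apply,
      frameMap_frameInv h₂ hp hq, mulVec_mulVec]

theorem stiefelAction_free {G : Type*} [Group G] {ρ : G →* specialUnitaryGroup (Fin 3) ℂ}
    (hρ : Function.Injective ρ) (g : G) (v : EuclideanSpace ℝ (Fin 6))
    (x : EuclideanSpace ℝ (Fin 8)) (hv : ‖v‖ = 1) (hx : x ≠ 0) (t : ℝ) (ht : 0 < t)
    (hgv : (stiefelAction ρ).base g v = v) (hgx : (stiefelAction ρ).fiber g v x = t • x) :
    g = 1 := by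
  have h : star (realSixEquiv v) ⬝ᵥ realSixEquiv v = 1 := by
    simp [dotProduct_star_realSixEquiv, hv]
  obtain ⟨hp, hq⟩ := dotProduct_frameMap h (realEightEquiv x)
  have hgv' : (ρ g).1 *ᵥ realSixEquiv v = realSixEquiv v :=
    (ContinuousLinearEquiv.symm_apply_eq _).1 hgv
  simp only [stiefelAction, hgv', ContinuousLinearEquiv.symm_apply_eq] at hgx
  have hX := congrArg (frameMap (realSixEquiv v) (star (realSixEquiv v))) hgx
  have smul (t : ℝ) {n : ℕ} (x : Fin n → ℂ) : t • x = (t : ℂ) • x := rfl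
  set X := frameMap (realSixEquiv v) (star (realSixEquiv v)) (realEightEquiv x) with hXdef
  have hp' := dotProduct_star_mulVec (ρ g).2 (realSixEquiv v) X.1
  have hq' := dotProduct_star_mulVec (ρ g).2 (realSixEquiv v) X.2
  rw [hgv'] at hp' hq'
  rw [frameMap_frameInv h (hp'.trans hp) (hq'.trans hq), map_smul, smul, frameMap_smul, ← hXdef]
    at hX
  have hX₀ : X ≠ 0 := by
    intro h₀
    have := frameInv_frameMap h (realEightEquiv x)
    rw [← hXdef, h₀, ← zero_smul ℂ (0 : (Fin 3 → ℂ) × (Fin 3 → ℂ)), frameInv_smul, zero_smul,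
      eq_comm, ContinuousLinearEquiv.map_eq_zero_iff] at this
    exact hx this
  have hfix {p : Fin 3 → ℂ} (hgp : (ρ g).1 *ᵥ p = t • p) (hp : star (realSixEquiv v) ⬝ᵥ p = 0)
      (hp₀ : p ≠ 0) : g = 1 := by
    apply hρ
    rw [map_one]
    refine Subtype.ext (eq_one_of_mem_specialUnitaryGroup (ρ g).2 ?_ hp₀ hp hgv'
      (mulVec_eq_self_of_smul (ρ g).2 ht hgp))
    rintro h₀
    simp [h₀] at h
  by_cases hp₀ : X.1 = 0
  · exact hfix (congrArg Prod.snd hX) hq fun hq₀ => hX₀ (Prod.ext hp₀ hq₀)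
  · exact hfix (congrArg Prod.fst hX) hp hp₀

end StiefelAction

/-- **Adem (after Stiefel-bundle trivialization).** The simple group `SL₃(𝔽₂)` of order
`168` acts freely and smoothly on the manifold `S⁵ × S⁷`: there is an action by
homeomorphisms, each of which is smooth (hence a diffeomorphism), with no nontrivial
element fixing a point. -/
theorem sl3_f2_acts_freely_smoothly_on_s5_x_s7 :
    ∃ φ : Matrix.SpecialLinearGroup (Fin 3) (ZMod 2) →*
        ((Sph 5 × Sph 7) ≃ₜ (Sph 5 × Sph 7)),
      (∀ g, ContMDiff ((𝓡 5).prod (𝓡 7)) ((𝓡 5).prod (𝓡 7)) (⊤ : ℕ∞) (φ g)) ∧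
      (∀ (g) (x : Sph 5 × Sph 7), φ g x = x → g = 1) := by
  let A := stiefelAction KleinInt.rep
  exact ⟨A.toHom, A.contMDiff_toFun, fun g => A.toHom_free g
    (stiefelAction_free KleinInt.rep_injective g)⟩
end

section
/- Every finite subgroup G of SU(3) (the group of 3×3 complex unitary matrices of determinant 1) acts freely and smoothly on the manifold S⁵ × S⁷; that is, there is a free action of G on S⁵ × S⁷ in which every group element acts by a diffeomorphism. -/
open Metric

open scoped Manifold

open Matrix
open scoped ContDiff

/-- The complex Householder matrix taking the basis vector at `i` to the unit vector `f`. -/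
noncomputable def householder {n : Type*} [DecidableEq n] (i : n) (f : n → ℂ) : Matrix n n ℂ :=
  1 - (1 - star (f i))⁻¹ • vecMulVec (Pi.single i 1 - f) (star (Pi.single i 1 - f))

section Householder

variable {n : Type*} [Fintype n] [DecidableEq n]

theorem householder_mulVec_single (i : n) (f : n → ℂ) (hi : f i ≠ 1) :
    householder i f *ᵥ Pi.single i 1 = f := by
  have hc : 1 - star (f i) ≠ 0 := fun h => hi <| by
    simpa using (congrArg star (sub_eq_zero.1 h)).symm
  have hd : star (Pi.single i 1 - f) ⬝ᵥ Pi.single i 1 = 1 - star (f i) := by simp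
  rw [householder, sub_mulVec, one_mulVec, smul_mulVec, vecMulVec_mulVec, hd, op_smul_eq_smul,
    smul_smul, inv_mul_cancel₀ hc, one_smul, sub_sub_cancel]

theorem householder_conjTranspose_mul_self (i : n) (f : n → ℂ) (hf : star f ⬝ᵥ f = 1)
    (hi : f i ≠ 1) : (householder i f)ᴴ * householder i f = 1 := by
  have hc : 1 - star (f i) ≠ 0 := fun h => hi <| by
    simpa using (congrArg star (sub_eq_zero.1 h)).symm
  have hc' : 1 - f i ≠ 0 := sub_ne_zero.2 hi.symm
  have hd : star (Pi.single i 1 - f) ⬝ᵥ (Pi.single i 1 - f) = (1 - star (f i)) + (1 - f i) := by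
    rw [star_sub, sub_dotProduct, dotProduct_sub, dotProduct_sub, hf]
    simp
    ring
  have hk : (1 - f i)⁻¹ * ((1 - star (f i))⁻¹ * (1 - star (f i) + (1 - f i))) =
      (1 - f i)⁻¹ + (1 - star (f i))⁻¹ := by
    field_simp
  have hs : star (1 - star (f i))⁻¹ = (1 - f i)⁻¹ := by simp
  rw [householder, conjTranspose_sub, conjTranspose_one, conjTranspose_smul,
    conjTranspose_vecMulVec, star_star, sub_mul, mul_sub, mul_sub, smul_mul_smul_comm,
    vecMulVec_mul_vecMulVec, hd, vecMulVec_smul, smul_smul, hs, mul_assoc, hk, add_smul]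
  simp

end Householder

/-- The orthogonal projection onto the complement of the unit vector `x`. -/
noncomputable def perpProj (x : Fin 3 → ℂ) : Matrix (Fin 3) (Fin 3) ℂ := 1 - vecMulVec x (star x)

section PerpProj

variable {x : Fin 3 → ℂ}

theorem perpProj_conjTranspose (x : Fin 3 → ℂ) : (perpProj x)ᴴ = perpProj x := by
  simp [perpProj, conjTranspose_vecMulVec]

theorem perpProj_mulVec_self (hx : star x ⬝ᵥ x = 1) : perpProj x *ᵥ x = 0 := by
  simp [perpProj, sub_mulVec, vecMulVec_mulVec, hx]

theorem star_vecMul_perpProj (hx : star x ⬝ᵥ x = 1) : star x ᵥ* perpProj x = 0 := by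
  simp [perpProj, vecMul_sub, vecMul_vecMulVec, hx]

theorem perpProj_mul_self (hx : star x ⬝ᵥ x = 1) : perpProj x * perpProj x = perpProj x := by
  nth_rw 2 [perpProj]
  rw [mul_sub, mul_one, mul_vecMulVec, perpProj_mulVec_self hx, zero_vecMulVec, sub_zero]

theorem mul_perpProj {U : Matrix (Fin 3) (Fin 3) ℂ} (hU : Uᴴ * U = 1) (x : Fin 3 → ℂ) :
    U * perpProj x = perpProj (U *ᵥ x) * U := by
  have h : U * Uᴴ = 1 := mul_eq_one_comm.1 hU
  rw [perpProj, perpProj, mul_sub, sub_mul, mul_vecMulVec, vecMulVec_mul, star_mulVec,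
    vecMul_vecMul, hU]
  simp

end PerpProj

/-- The standard inclusion of `ℂ²` into `ℂ³`. -/
def inclTwo : Matrix (Fin 3) (Fin 2) ℂ := !![1, 0; 0, 1; 0, 0]

/-- For a unit vector `x`, an isometry from `ℂ⁵` onto `x^⊥ ⊕ ℂ³`. -/
noncomputable def perpSumIso (x : Fin 3 → ℂ) : Matrix (Fin 3 ⊕ Fin 3) (Fin 3 ⊕ Fin 2) ℂ :=
  fromBlocks (perpProj x) 0 (vecMulVec (Pi.single 2 1) (star x)) inclTwo

/-- The unit vector of `ℂ⁵` corresponding to `(0, x)` under `perpSumIso x`. -/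
noncomputable def perpSumVec (x : Fin 3 → ℂ) : Fin 3 ⊕ Fin 2 → ℂ :=
  (perpSumIso x)ᴴ *ᵥ Sum.elim 0 x

/-- For a unit vector `x`, an isometry from `ℂ⁴` onto `x^⊥ ⊕ x^⊥`. -/
noncomputable def perpTriv (x : Fin 3 → ℂ) :
    Matrix (Fin 3 ⊕ Fin 3) {j : Fin 3 ⊕ Fin 2 // j ≠ Sum.inl 0} ℂ :=
  (perpSumIso x * householder (Sum.inl 0) (perpSumVec x)).submatrix id Subtype.val

section PerpTriv

variable {x : Fin 3 → ℂ}

theorem perpSumIso_mul_conjTranspose (hx : star x ⬝ᵥ x = 1) :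
    perpSumIso x * (perpSumIso x)ᴴ = fromBlocks (perpProj x) 0 0 1 := by
  have h : vecMulVec (Pi.single 2 1) (star (Pi.single 2 1)) + inclTwo * inclTwoᴴ =
      (1 : Matrix (Fin 3) (Fin 3) ℂ) := by
    ext i j
    rw [Matrix.add_apply, mul_apply, Fin.sum_univ_two]
    fin_cases i <;> fin_cases j <;> simp [inclTwo, vecMulVec_apply]
  simp only [perpSumIso, fromBlocks_conjTranspose, fromBlocks_multiply, perpProj_conjTranspose,
    perpProj_mul_self hx, conjTranspose_vecMulVec, mul_vecMulVec, vecMulVec_mul, star_star,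
    perpProj_mulVec_self hx, star_vecMul_perpProj hx, vecMulVec_mulVec, hx,
    MulOpposite.op_one, one_smul, h, conjTranspose_zero, Matrix.mul_zero, Matrix.zero_mul,
    vecMulVec_zero, zero_vecMulVec, add_zero]

theorem conjTranspose_mul_perpSumIso (hx : star x ⬝ᵥ x = 1) :
    (perpSumIso x)ᴴ * perpSumIso x = 1 := by
  have h : inclTwoᴴ * inclTwo = 1 := by
    ext i j
    fin_cases i <;> fin_cases j <;> simp [inclTwo, mul_apply, Fin.sum_univ_three]
  have h1 : vecMulVec x (star (Pi.single 2 1 : Fin 3 → ℂ)) * inclTwo = 0 := by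
    ext i j
    fin_cases j <;> simp [inclTwo, mul_apply, vecMulVec_apply, Fin.sum_univ_three]
  have h2 : inclTwoᴴ * vecMulVec (Pi.single 2 1 : Fin 3 → ℂ) (star x) = 0 := by
    ext i j
    fin_cases i <;> simp [inclTwo, mul_apply, vecMulVec_apply, Fin.sum_univ_three]
  have h3 : star (Pi.single 2 1 : Fin 3 → ℂ) ⬝ᵥ Pi.single 2 1 = 1 := by simp
  simp only [perpSumIso, fromBlocks_conjTranspose, fromBlocks_multiply, perpProj_conjTranspose,
    perpProj_mul_self hx, conjTranspose_vecMulVec, vecMulVec_mul_vecMulVec, star_star, h3, h,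
    h1, h2]
  simp [perpProj]

theorem perpSumIso_mulVec_perpSumVec (hx : star x ⬝ᵥ x = 1) :
    perpSumIso x *ᵥ perpSumVec x = Sum.elim (0 : Fin 3 → ℂ) x := by
  simp [perpSumVec, mulVec_mulVec, perpSumIso_mul_conjTranspose hx, fromBlocks_mulVec]

theorem star_perpSumVec_dotProduct_self (hx : star x ⬝ᵥ x = 1) :
    star (perpSumVec x) ⬝ᵥ perpSumVec x = 1 := by
  nth_rw 1 [perpSumVec]
  rw [star_mulVec, conjTranspose_conjTranspose, ← dotProduct_mulVec,
    perpSumIso_mulVec_perpSumVec hx]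
  simpa [dotProduct, Fintype.sum_sum_type] using hx

theorem perpSumVec_apply_ne_one (hx : star x ⬝ᵥ x = 1) : perpSumVec x (Sum.inl 0) ≠ 1 := by
  have h0 : perpSumVec x (Sum.inl 0) = x 0 * x 2 := by
    simp [perpSumVec, perpSumIso, mulVec, dotProduct, Fintype.sum_sum_type, Fin.sum_univ_three,
      vecMulVec_apply]
  rw [h0]
  intro h
  have h1 : ‖x 0‖ * ‖x 2‖ = 1 := by rw [← norm_mul, h, norm_one]
  have h2 : ‖x 0‖ ^ 2 + ‖x 1‖ ^ 2 + ‖x 2‖ ^ 2 = 1 := by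
    have : ((‖x 0‖ ^ 2 + ‖x 1‖ ^ 2 + ‖x 2‖ ^ 2 : ℝ) : ℂ) = 1 := by
      rw [← hx]
      simp [dotProduct, Fin.sum_univ_three, Complex.conj_mul']
    exact_mod_cast this
  nlinarith [sq_nonneg (‖x 0‖ - ‖x 2‖), sq_nonneg ‖x 1‖]

theorem conjTranspose_mul_perpTriv (hx : star x ⬝ᵥ x = 1) : (perpTriv x)ᴴ * perpTriv x = 1 := by
  rw [perpTriv, conjTranspose_submatrix, ← submatrix_mul _ _ _ id _ Function.bijective_id,
    conjTranspose_mul, Matrix.mul_assoc, ← Matrix.mul_assoc _ (perpSumIso x),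
    conjTranspose_mul_perpSumIso hx, Matrix.one_mul,
    householder_conjTranspose_mul_self _ _ (star_perpSumVec_dotProduct_self hx)
      (perpSumVec_apply_ne_one hx), submatrix_one _ Subtype.val_injective]

theorem submatrix_ne_mul_conjTranspose {m n : Type*} [Fintype n] [DecidableEq n]
    (A : Matrix m n ℂ) (i : n) :
    (A.submatrix id Subtype.val : Matrix m {j // j ≠ i} ℂ) *
        (A.submatrix id Subtype.val : Matrix m {j // j ≠ i} ℂ)ᴴ =
      A * Aᴴ - vecMulVec (A *ᵥ Pi.single i 1) (star (A *ᵥ Pi.single i 1)) := by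
  ext a b
  rw [Matrix.sub_apply, mul_apply, mul_apply, Fintype.sum_eq_add_sum_subtype_ne _ i]
  simp [vecMulVec_apply]

theorem perpTriv_mul_conjTranspose (hx : star x ⬝ᵥ x = 1) :
    perpTriv x * (perpTriv x)ᴴ = fromBlocks (perpProj x) 0 0 (perpProj x) := by
  have hH := householder_conjTranspose_mul_self _ _ (star_perpSumVec_dotProduct_self hx)
      (perpSumVec_apply_ne_one hx)
  rw [perpTriv, submatrix_ne_mul_conjTranspose, conjTranspose_mul, Matrix.mul_assoc,
    ← Matrix.mul_assoc _ _ (perpSumIso x)ᴴ, mul_eq_one_comm.1 hH, Matrix.one_mul,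
    perpSumIso_mul_conjTranspose hx, ← mulVec_mulVec,
    householder_mulVec_single _ _ (perpSumVec_apply_ne_one hx), perpSumIso_mulVec_perpSumVec hx]
  ext (a | a) (b | b) <;> simp [perpProj, vecMulVec_apply, one_apply]

end PerpTriv

section Smooth

variable {E : Type*} [NormedAddCommGroup E] [NormedSpace ℝ E] {l m n : Type*} {z : E}

theorem ContDiffAt.star_complex {f : E → ℂ} (hf : ContDiffAt ℝ ∞ f z) :
    ContDiffAt ℝ ∞ (fun w => star (f w)) z :=
  Complex.conjCLE.contDiff.contDiffAt.comp z hf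

theorem contDiffAt_mul_apply [Fintype m] {A : E → Matrix l m ℂ} {B : E → Matrix m n ℂ}
    (hA : ∀ i j, ContDiffAt ℝ ∞ (fun w => A w i j) z)
    (hB : ∀ i j, ContDiffAt ℝ ∞ (fun w => B w i j) z) (i : l) (j : n) :
    ContDiffAt ℝ ∞ (fun w => (A w * B w) i j) z := by
  simp only [mul_apply]
  exact ContDiffAt.sum fun k _ => (hA i k).mul (hB k j)

theorem contDiffAt_mulVec_apply [Fintype m] {A : E → Matrix l m ℂ} {v : E → m → ℂ}
    (hA : ∀ i j, ContDiffAt ℝ ∞ (fun w => A w i j) z)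
    (hv : ∀ i, ContDiffAt ℝ ∞ (fun w => v w i) z) (i : l) :
    ContDiffAt ℝ ∞ (fun w => (A w *ᵥ v w) i) z := by
  simp only [mulVec, dotProduct]
  exact ContDiffAt.sum fun k _ => (hA i k).mul (hv k)

theorem contDiffAt_conjTranspose_apply {A : E → Matrix l m ℂ}
    (hA : ∀ i j, ContDiffAt ℝ ∞ (fun w => A w i j) z) (i : m) (j : l) :
    ContDiffAt ℝ ∞ (fun w => (A w)ᴴ i j) z :=
  (hA j i).star_complex

theorem contDiffAt_vecMulVec_apply {u : E → l → ℂ} {v : E → m → ℂ}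
    (hu : ∀ i, ContDiffAt ℝ ∞ (fun w => u w i) z)
    (hv : ∀ i, ContDiffAt ℝ ∞ (fun w => v w i) z) (i : l) (j : m) :
    ContDiffAt ℝ ∞ (fun w => vecMulVec (u w) (v w) i j) z :=
  (hu i).mul (hv j)

theorem contDiffAt_householder_apply [DecidableEq n] {f : E → n → ℂ} {k : n}
    (hf : ∀ i, ContDiffAt ℝ ∞ (fun w => f w i) z) (hk : f z k ≠ 1) (i j : n) :
    ContDiffAt ℝ ∞ (fun w => householder k (f w) i j) z := by
  have hc : 1 - star (f z k) ≠ 0 := fun h => hk <| by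
    simpa using (congrArg star (sub_eq_zero.1 h)).symm
  have hu (i) : ContDiffAt ℝ ∞ (fun w => (Pi.single k 1 - f w : n → ℂ) i) z :=
    contDiffAt_const.sub (hf i)
  exact contDiffAt_const.sub (((contDiffAt_const.sub (hf k).star_complex).inv hc).mul
    (contDiffAt_vecMulVec_apply hu (fun i => (hu i).star_complex) i j))

theorem contDiffAt_perpSumIso_apply {x : E → Fin 3 → ℂ}
    (hx : ∀ i, ContDiffAt ℝ ∞ (fun w => x w i) z) (i : Fin 3 ⊕ Fin 3) (j : Fin 3 ⊕ Fin 2) :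
    ContDiffAt ℝ ∞ (fun w => perpSumIso (x w) i j) z := by
  rcases i with i | i <;> rcases j with j | j
  · exact contDiffAt_const.sub
      (contDiffAt_vecMulVec_apply hx (fun i => (hx i).star_complex) i j)
  · exact contDiffAt_const
  · exact contDiffAt_vecMulVec_apply (u := fun _ => Pi.single 2 1) (fun _ => contDiffAt_const)
      (fun i => (hx i).star_complex) i j
  · exact contDiffAt_const

theorem contDiffAt_perpTriv_apply {x : E → Fin 3 → ℂ} (hz : star (x z) ⬝ᵥ x z = 1)
    (hx : ∀ i, ContDiffAt ℝ ∞ (fun w => x w i) z) (i : Fin 3 ⊕ Fin 3)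
    (j : {j : Fin 3 ⊕ Fin 2 // j ≠ Sum.inl 0}) :
    ContDiffAt ℝ ∞ (fun w => perpTriv (x w) i j) z := by
  refine contDiffAt_mul_apply (contDiffAt_perpSumIso_apply hx)
    (contDiffAt_householder_apply
    (f := fun w => perpSumVec (x w)) (contDiffAt_mulVec_apply
      (contDiffAt_conjTranspose_apply (contDiffAt_perpSumIso_apply hx)) ?_)
      (perpSumVec_apply_ne_one hz)) i j
  rintro (i | i)
  · exact contDiffAt_const
  · exact hx i

end Smooth

section Cross

theorem mulVec_cross_mulVec_s14 (U : Matrix (Fin 3) (Fin 3) ℂ) (a b : Fin 3 → ℂ) :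
    crossProduct (U *ᵥ a) (U *ᵥ b) = (adjugate U)ᵀ *ᵥ crossProduct a b := by
  ext i
  fin_cases i <;>
    simp [cross_apply, adjugate_fin_three, mulVec, dotProduct, Fin.sum_univ_three] <;> ring

open scoped ComplexOrder in
/-- A special unitary `3 × 3` matrix fixing two nonzero orthogonal vectors is the identity. -/
theorem eq_one_of_fixes_orthogonal {U : Matrix (Fin 3) (Fin 3) ℂ} (hU : Uᴴ * U = 1)
    (hdet : U.det = 1) {x w : Fin 3 → ℂ} (hx : x ≠ 0) (hw : w ≠ 0) (hxw : star x ⬝ᵥ w = 0)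
    (hUx : U *ᵥ x = x) (hUw : U *ᵥ w = w) : U = 1 := by
  have hadj : adjugate U = Uᴴ := by
    calc adjugate U = Uᴴ * U * adjugate U := by rw [hU, Matrix.one_mul]
      _ = Uᴴ := by rw [Matrix.mul_assoc, mul_adjugate, hdet, one_smul, Matrix.mul_one]
  have hz : U *ᵥ star (crossProduct x w) = star (crossProduct x w) := by
    have h := mulVec_cross_mulVec_s14 U x w
    rw [hUx, hUw, hadj] at h
    conv_rhs => rw [h]
    ext i
    simp [mulVec, dotProduct]
  have hc : star (crossProduct x w) ⬝ᵥ crossProduct x w ≠ 0 := by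
    have h1 : star (crossProduct x w) = crossProduct (star x) (star w) := by
      ext i
      fin_cases i <;> simp [cross_apply]
    rw [h1, cross_dot_cross, hxw, zero_mul, sub_zero]
    exact mul_ne_zero (dotProduct_star_self_eq_zero.not.2 hx)
      (dotProduct_star_self_eq_zero.not.2 hw)
  rw [triple_product_eq_det] at hc
  set M : Matrix (Fin 3) (Fin 3) ℂ := ![star (crossProduct x w), x, w] with hM
  have hMU : M * Uᵀ = M := by
    ext i j
    rw [mul_apply_eq_vecMul, vecMul_transpose]
    fin_cases i <;> simp [hM, hz, hUx, hUw]
  have := (isUnit_iff_isUnit_det M).2 (isUnit_iff_ne_zero.2 hc)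
  have h : Uᵀ = 1 := this.mul_left_cancel (hMU.trans (mul_one M).symm)
  rw [← transpose_transpose U, h, transpose_one]

end Cross

theorem star_mulVec_dotProduct_mulVec {m n : Type*} [Fintype m] [Fintype n] [DecidableEq n]
    {A : Matrix m n ℂ} (hA : Aᴴ * A = 1) (v : n → ℂ) :
    star (A *ᵥ v) ⬝ᵥ (A *ᵥ v) = star v ⬝ᵥ v := by
  rw [star_mulVec, ← dotProduct_mulVec, mulVec_mulVec, hA, one_mulVec]

/-- The map of fibres `x^⊥ ⊕ x^⊥ → (U x)^⊥ ⊕ (U x)^⊥` induced by `U ⊕ U`, read in the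
trivialization `perpTriv`. -/
noncomputable def fiberAct (U : Matrix (Fin 3) (Fin 3) ℂ) (x : Fin 3 → ℂ)
    (y : {j : Fin 3 ⊕ Fin 2 // j ≠ Sum.inl 0} → ℂ) : {j : Fin 3 ⊕ Fin 2 // j ≠ Sum.inl 0} → ℂ :=
  (perpTriv (U *ᵥ x))ᴴ *ᵥ (fromBlocks U 0 0 U *ᵥ (perpTriv x *ᵥ y))

section FiberAct

variable {x : Fin 3 → ℂ} {U V : Matrix (Fin 3) (Fin 3) ℂ}

theorem perpTriv_mulVec_fiberAct (hx : star x ⬝ᵥ x = 1) (hU : Uᴴ * U = 1)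
    (y : {j : Fin 3 ⊕ Fin 2 // j ≠ Sum.inl 0} → ℂ) :
    perpTriv (U *ᵥ x) *ᵥ fiberAct U x y = fromBlocks U 0 0 U *ᵥ (perpTriv x *ᵥ y) := by
  have hUx : star (U *ᵥ x) ⬝ᵥ (U *ᵥ x) = 1 := (star_mulVec_dotProduct_mulVec hU x).trans hx
  have h : fromBlocks (perpProj (U *ᵥ x)) 0 0 (perpProj (U *ᵥ x)) * fromBlocks U 0 0 U =
      fromBlocks U 0 0 U * (perpTriv x * (perpTriv x)ᴴ) := by
    rw [perpTriv_mul_conjTranspose hx]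
    simp [fromBlocks_multiply, mul_perpProj hU]
  rw [fiberAct, mulVec_mulVec, perpTriv_mul_conjTranspose hUx, mulVec_mulVec, h, mulVec_mulVec,
    Matrix.mul_assoc, Matrix.mul_assoc, conjTranspose_mul_perpTriv hx, Matrix.mul_one,
    ← mulVec_mulVec]

theorem star_fiberAct_dotProduct_self (hx : star x ⬝ᵥ x = 1) (hU : Uᴴ * U = 1)
    (y : {j : Fin 3 ⊕ Fin 2 // j ≠ Sum.inl 0} → ℂ) :
    star (fiberAct U x y) ⬝ᵥ fiberAct U x y = star y ⬝ᵥ y := by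
  have hUx : star (U *ᵥ x) ⬝ᵥ (U *ᵥ x) = 1 := (star_mulVec_dotProduct_mulVec hU x).trans hx
  have hD : (fromBlocks U 0 0 U)ᴴ * fromBlocks U 0 0 U = 1 := by
    simp [fromBlocks_conjTranspose, fromBlocks_multiply, hU]
  rw [← star_mulVec_dotProduct_mulVec (conjTranspose_mul_perpTriv hUx),
    perpTriv_mulVec_fiberAct hx hU, star_mulVec_dotProduct_mulVec hD,
    star_mulVec_dotProduct_mulVec (conjTranspose_mul_perpTriv hx)]

theorem fiberAct_one (hx : star x ⬝ᵥ x = 1) (y : {j : Fin 3 ⊕ Fin 2 // j ≠ Sum.inl 0} → ℂ) :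
    fiberAct 1 x y = y := by
  rw [fiberAct, fromBlocks_one, one_mulVec, one_mulVec, mulVec_mulVec,
    conjTranspose_mul_perpTriv hx, one_mulVec]

theorem fiberAct_mul (hx : star x ⬝ᵥ x = 1) (hV : Vᴴ * V = 1)
    (y : {j : Fin 3 ⊕ Fin 2 // j ≠ Sum.inl 0} → ℂ) :
    fiberAct (U * V) x y = fiberAct U (V *ᵥ x) (fiberAct V x y) := by
  have h : fromBlocks (U * V) 0 0 (U * V) = fromBlocks U 0 0 U * fromBlocks V 0 0 V := by
    simp [fromBlocks_multiply]
  rw [fiberAct, fiberAct, perpTriv_mulVec_fiberAct hx hV, h]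
  simp only [mulVec_mulVec, Matrix.mul_assoc]

theorem eq_one_of_fiberAct_eq_self (hx : star x ⬝ᵥ x = 1) (hU : Uᴴ * U = 1) (hdet : U.det = 1)
    {y : {j : Fin 3 ⊕ Fin 2 // j ≠ Sum.inl 0} → ℂ} (hy : y ≠ 0) (hUx : U *ᵥ x = x)
    (hUy : fiberAct U x y = y) : U = 1 := by
  have hx0 : x ≠ 0 := by
    rintro rfl
    simp at hx
  set t := perpTriv x *ᵥ y with ht
  have ht0 : t ≠ 0 := fun h => hy <| by
    rw [← one_mulVec y, ← conjTranspose_mul_perpTriv hx, ← mulVec_mulVec, ← ht, h, mulVec_zero]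
  have hUt : fromBlocks U 0 0 U *ᵥ t = t := by
    rw [ht, ← perpTriv_mulVec_fiberAct hx hU, hUx, hUy]
  have hPt : fromBlocks (perpProj x) 0 0 (perpProj x) *ᵥ t = t := by
    rw [← perpTriv_mul_conjTranspose hx, ht, mulVec_mulVec, Matrix.mul_assoc,
      conjTranspose_mul_perpTriv hx, Matrix.mul_one]
  have key (w : Fin 3 → ℂ) (hw : w ≠ 0) (hPw : perpProj x *ᵥ w = w) (hUw : U *ᵥ w = w) :
      U = 1 := by
    refine eq_one_of_fixes_orthogonal hU hdet hx0 hw ?_ hUx hUw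
    rw [← hPw, dotProduct_mulVec, star_vecMul_perpProj hx, zero_dotProduct]
  rw [fromBlocks_mulVec] at hUt hPt
  by_cases h : t ∘ Sum.inl = 0
  · refine key (t ∘ Sum.inr) (fun h' => ht0 ?_) ?_ ?_
    · ext (i | i)
      exacts [congrFun h i, congrFun h' i]
    · simpa using congrArg (· ∘ Sum.inr) hPt
    · simpa using congrArg (· ∘ Sum.inr) hUt
  · refine key (t ∘ Sum.inl) h ?_ ?_
    · simpa using congrArg (· ∘ Sum.inl) hPt
    · simpa using congrArg (· ∘ Sum.inl) hUt

theorem contDiffAt_fiberAct_apply {E : Type*} [NormedAddCommGroup E] [NormedSpace ℝ E] {z : E}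
    {x : E → Fin 3 → ℂ} {y : E → {j : Fin 3 ⊕ Fin 2 // j ≠ Sum.inl 0} → ℂ}
    (hz : star (x z) ⬝ᵥ x z = 1) (hU : Uᴴ * U = 1)
    (hx : ∀ i, ContDiffAt ℝ ∞ (fun w => x w i) z) (hy : ∀ i, ContDiffAt ℝ ∞ (fun w => y w i) z)
    (i : {j : Fin 3 ⊕ Fin 2 // j ≠ Sum.inl 0}) :
    ContDiffAt ℝ ∞ (fun w => fiberAct U (x w) (y w) i) z := by
  have hUx := contDiffAt_mulVec_apply (A := fun _ => U) (fun _ _ => contDiffAt_const) hx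
  have hUz : star (U *ᵥ x z) ⬝ᵥ (U *ᵥ x z) = 1 := (star_mulVec_dotProduct_mulVec hU _).trans hz
  have hT := contDiffAt_perpTriv_apply hz hx
  have hT' := contDiffAt_conjTranspose_apply
    (contDiffAt_perpTriv_apply (x := fun w => U *ᵥ x w) hUz hUx)
  have hTy := contDiffAt_mulVec_apply hT hy
  have hD := contDiffAt_mulVec_apply (A := fun _ => fromBlocks U 0 0 U)
    (fun _ _ => contDiffAt_const) hTy
  simp only [fiberAct]
  exact contDiffAt_mulVec_apply hT' hD i

end FiberAct

/-- Complex coordinates on an even-dimensional real Euclidean space. -/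
theorem exists_complex_coordinates {n : ℕ} (ι : Type*) [Fintype ι] (h : n = 2 * Fintype.card ι) :
    ∃ e : EuclideanSpace ℝ (Fin n) ≃L[ℝ] (ι → ℂ),
      ∀ v, star (e v) ⬝ᵥ e v = ((‖v‖ ^ 2 : ℝ) : ℂ) := by
  have hfin : Module.finrank ℝ (EuclideanSpace ℝ (Fin n)) =
      Module.finrank ℝ (EuclideanSpace ℂ ι) := by
    rw [finrank_real_of_complex]
    simpa using h
  let i := (stdOrthonormalBasis ℝ (EuclideanSpace ℝ (Fin n))).equiv
    (stdOrthonormalBasis ℝ (EuclideanSpace ℂ ι)) (finCongr hfin)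
  refine ⟨i.toContinuousLinearEquiv.trans
    (PiLp.continuousLinearEquiv 2 ℝ fun _ : ι => ℂ), fun v => ?_⟩
  rw [← i.norm_map v, EuclideanSpace.norm_sq_eq]
  simp [dotProduct, Complex.conj_mul']

theorem contMDiff_sphere_prod_of_contDiffAt {l m n : ℕ}
    {f : EuclideanSpace ℝ (Fin (m + 1)) × EuclideanSpace ℝ (Fin (n + 1)) →
      EuclideanSpace ℝ (Fin (l + 1))}
    (hf : ∀ p : Sph m × Sph n, ContDiffAt ℝ ∞ f (p.1, p.2))
    (hs : ∀ p : Sph m × Sph n, f (p.1, p.2) ∈ sphere 0 1) :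
    ContMDiff ((𝓡 m).prod (𝓡 n)) (𝓡 l) ∞
      (fun p : Sph m × Sph n => (⟨f (p.1, p.2), hs p⟩ : Sph l)) := by
  have hfact (d : ℕ) : Fact (Module.finrank ℝ (EuclideanSpace ℝ (Fin (d + 1))) = d + 1) :=
    ⟨finrank_euclideanSpace_fin⟩
  have h1 : ContMDiff ((𝓡 m).prod (𝓡 n)) 𝓘(ℝ, EuclideanSpace ℝ (Fin (m + 1))) ∞
      (fun p : Sph m × Sph n => (p.1 : EuclideanSpace ℝ (Fin (m + 1)))) :=
    contMDiff_coe_sphere.comp contMDiff_fst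
  have h2 : ContMDiff ((𝓡 m).prod (𝓡 n)) 𝓘(ℝ, EuclideanSpace ℝ (Fin (n + 1))) ∞
      (fun p : Sph m × Sph n => (p.2 : EuclideanSpace ℝ (Fin (n + 1)))) :=
    contMDiff_coe_sphere.comp contMDiff_snd
  exact ContMDiff.codRestrict_sphere (f := fun p : Sph m × Sph n => f (p.1, p.2))
    (fun p => ContDiffAt.comp_contMDiffAt (hf p) (h1.prodMk_space h2 p)) hs

/-- **Adem–Davis–Unlu (special case).** Every finite subgroup `G` of `SU(3)` — here a
finite group together with an injective homomorphism into the unitary group `U(3)` landing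
in the matrices of determinant `1` — acts freely and smoothly on the manifold `S⁵ × S⁷`:
there is an action by homeomorphisms, each of which is smooth (hence a diffeomorphism),
with no nontrivial element fixing a point. -/
theorem finite_subgroup_of_su3_acts_freely_smoothly_on_s5_x_s7
    (G : Type) [Group G] [Finite G]
    (ρ : G →* Matrix.unitaryGroup (Fin 3) ℂ)
    (hρ : Function.Injective ρ)
    (hdet : ∀ g : G, Matrix.det (ρ g : Matrix (Fin 3) (Fin 3) ℂ) = 1) :
    ∃ φ : G →* ((Sph 5 × Sph 7) ≃ₜ (Sph 5 × Sph 7)),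
      (∀ g, ContMDiff ((𝓡 5).prod (𝓡 7)) ((𝓡 5).prod (𝓡 7)) (⊤ : ℕ∞) (φ g)) ∧
      (∀ (g) (x : Sph 5 × Sph 7), φ g x = x → g = 1) := by
  obtain ⟨e, he⟩ := exists_complex_coordinates (n := 5 + 1) (Fin 3) (by simp)
  obtain ⟨k, hk⟩ := exists_complex_coordinates (n := 7 + 1)
    {j : Fin 3 ⊕ Fin 2 // j ≠ Sum.inl 0} (by simp [Fintype.card_subtype_compl])
  have he1 (x : Sph 5) : star (e x) ⬝ᵥ e x = 1 := by simp [he]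
  have hk1 (y : Sph 7) : star (k y) ⬝ᵥ k y = 1 := by simp [hk]
  have hes {v : Fin 3 → ℂ} (hv : star v ⬝ᵥ v = 1) : e.symm v ∈ sphere 0 1 := by
    have := he (e.symm v)
    rw [e.apply_symm_apply, hv] at this
    rw [mem_sphere_zero_iff_norm, ← sq_eq_sq₀ (norm_nonneg _) zero_le_one, one_pow]
    exact_mod_cast this.symm
  have hks {v : {j : Fin 3 ⊕ Fin 2 // j ≠ Sum.inl 0} → ℂ} (hv : star v ⬝ᵥ v = 1) :
      k.symm v ∈ sphere 0 1 := by
    have := hk (k.symm v)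
    rw [k.apply_symm_apply, hv] at this
    rw [mem_sphere_zero_iff_norm, ← sq_eq_sq₀ (norm_nonneg _) zero_le_one, one_pow]
    exact_mod_cast this.symm
  let r (g : G) : Matrix (Fin 3) (Fin 3) ℂ := ρ g
  have hr (g : G) : (r g)ᴴ * r g = 1 := (ρ g).2.1
  have hr1 : r 1 = 1 := by simp [r]
  have hrm (g h : G) : r (g * h) = r g * r h := by simp [r]
  let a (g : G) (p : Sph 5 × Sph 7) : Sph 5 × Sph 7 :=
    (⟨e.symm (r g *ᵥ e p.1),
        hes ((star_mulVec_dotProduct_mulVec (hr g) _).trans (he1 p.1))⟩,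
      ⟨k.symm (fiberAct (r g) (e p.1) (k p.2)),
        hks ((star_fiberAct_dotProduct_self (he1 p.1) (hr g) _).trans (hk1 p.2))⟩)
  have ha1 (p) : a 1 p = p := by
    refine Prod.ext (Subtype.ext ?_) (Subtype.ext ?_)
    · simp [a, hr1]
    · simp [a, hr1, fiberAct_one (he1 p.1)]
  have ham (g h p) : a (g * h) p = a g (a h p) := by
    refine Prod.ext (Subtype.ext ?_) (Subtype.ext ?_)
    · simp [a, hrm]
    · simp [a, hrm, fiberAct_mul (he1 p.1) (hr h)]
  have hsmooth (g) : ContMDiff ((𝓡 5).prod (𝓡 7)) ((𝓡 5).prod (𝓡 7)) (⊤ : ℕ∞) (a g) := by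
    refine ContMDiff.prodMk ?_ ?_
    · refine contMDiff_sphere_prod_of_contDiffAt (f := fun q => e.symm (r g *ᵥ e q.1))
        (fun p => ?_) _
      refine e.symm.contDiff.contDiffAt.comp _ (contDiffAt_pi.2 ?_)
      exact contDiffAt_mulVec_apply (fun _ _ => contDiffAt_const)
        (contDiffAt_pi.1 (e.contDiff.comp contDiff_fst).contDiffAt)
    · refine contMDiff_sphere_prod_of_contDiffAt
        (f := fun q => k.symm (fiberAct (r g) (e q.1) (k q.2))) (fun p => ?_) _
      refine k.symm.contDiff.contDiffAt.comp _ (contDiffAt_pi.2 ?_)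
      exact contDiffAt_fiberAct_apply (he1 p.1) (hr g)
        (contDiffAt_pi.1 (e.contDiff.comp contDiff_fst).contDiffAt)
        (contDiffAt_pi.1 (k.contDiff.comp contDiff_snd).contDiffAt)
  refine ⟨{
    toFun := fun g =>
      { toFun := a g
        invFun := a g⁻¹
        left_inv := fun p => by rw [← ham, inv_mul_cancel, ha1]
        right_inv := fun p => by rw [← ham, mul_inv_cancel, ha1]
        continuous_toFun := (hsmooth g).continuous
        continuous_invFun := (hsmooth g⁻¹).continuous }
    map_one' := Homeomorph.ext ha1
    map_mul' := fun g h => Homeomorph.ext (ham g h) }, hsmooth, fun g p hp => ?_⟩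
  have hp1 : e.symm (r g *ᵥ e p.1) = p.1 := congrArg (fun q => q.1.1) hp
  have hp2 : k.symm (fiberAct (r g) (e p.1) (k p.2)) = p.2 :=
    congrArg (fun q => q.2.1) hp
  have hk0 : k p.2 ≠ 0 := fun h => by simpa [h] using hk1 p.2
  refine hρ (Subtype.ext ?_)
  rw [map_one]
  exact eq_one_of_fiberAct_eq_self (he1 p.1) (hr g) (hdet g) hk0
    ((e.symm_apply_eq).1 hp1) ((k.symm_apply_eq).1 hp2)
end
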